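/- Every finite 5-edge-connected undirected graph G with destination t ∈ V admits a routing process that is 4-resilient against dynamic failures. -/

import Mathlib

namespace FRR

open scoped Classical

variable {V : Type*} [Fintype V] [DecidableEq V]

/-- `G` is `k`-edge-connected: removing any set of at most `k-1` edges keeps it connected. -/
def EdgeConnected (G : SimpleGraph V) (k : ℕ) : Prop :=
  ∀ F : Set (Sym2 V), F ⊆ G.edgeSet → F.ncard ≤ k - 1 → (G.deleteEdges F).Connected


/-- A (basic, deterministic) forwarding scheme on `G`: given the current node, the
in-port (the neighbor the packet arrived from, `none` for a freshly originated packet)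
and the set of currently active neighbors, it selects an active neighbor to forward to. -/
structure FwdScheme (G : SimpleGraph V) where
  fwd : V → Option V → Set V → V
  mem : ∀ (v : V) (ip : Option V) (A : Set V), A.Nonempty → fwd v ip A ∈ A

/-- The packet trajectory (current node, in-port) of a forwarding scheme with
destination `t`, started at `s`, under the failure schedule `σ`; the packet is
absorbed at `t` and gets stuck when no incident link is active. -/
noncomputable def FwdScheme.traj {G : SimpleGraph V} (P : FwdScheme G)
    (σ : ℕ → Set (Sym2 V)) (t s : V) : ℕ → V × Option V
  | 0 => (s, none)
  | n + 1 =>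
    let p := FwdScheme.traj P σ t s n
    if p.1 = t then p
    else if ({u : V | G.Adj p.1 u ∧ s(p.1, u) ∉ σ n} : Set V).Nonempty then
      (P.fwd p.1 p.2 {u : V | G.Adj p.1 u ∧ s(p.1, u) ∉ σ n}, some p.1)
    else p

/-- A forwarding scheme for destination `t` is `r`-resilient against dynamic failures:
for every unstable-link set `F` with `|F| ≤ r`, every (dynamic, i.e. arbitrary) failure
schedule `σ` on `F` whose induced trajectory satisfies the non-trap assumption, and
every source `s` connected to `t` in `G ∖ F`, the packet reaches `t` in finitely
many steps. -/
def DynResilient {G : SimpleGraph V} (P : FwdScheme G) (t : V) (r : ℕ) : Prop :=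
  ∀ F : Set (Sym2 V), F ⊆ G.edgeSet → F.ncard ≤ r →
    ∀ σ : ℕ → Set (Sym2 V), (∀ n, σ n ⊆ F) →
      ∀ s : V,
        (∀ n, (G.deleteEdges F).Reachable (P.traj σ t s n).1 (P.traj σ t s (n + 1)).1) →
        (G.deleteEdges F).Reachable s t →
        ∃ n, (P.traj σ t s n).1 = t

end FRR

namespace FRR
/-- Colour groups: `{0,2}`, `{1,3}`, `{4}`. -/
def grp (c : Fin 5) : Fin 3 := ![0, 1, 0, 1, 2] c

/-- Local winning position at a pinched vertex with out-colours `o`, in-colours `i`. -/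
def finOK (o i : Fin 4 → Fin 5) : Prop :=
  (∀ k l, o k = o l → k = l) ∧ (∀ k, grp (o k) ≠ grp (i k)) ∧
  ∀ m, (∀ k, o k ≠ m) → ∀ k l, grp (i k) = grp m → grp (i l) = grp m → k = l

instance (o i) : Decidable (finOK o i) := inferInstanceAs (Decidable (_ ∧ _ ∧ _))

def stepOK (o i : Fin 4 → Fin 5) (k : Fin 4) (m : Fin 5) : Prop :=
  (∀ j, o j ≠ m) ∧ grp m ≠ grp (i k)
instance (o i k m) : Decidable (stepOK o i k m) := inferInstanceAs (Decidable (_ ∧ _))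

def win : ℕ → (o i : Fin 4 → Fin 5) → Prop
  | 0, o, i => finOK o i
  | n+1, o, i => finOK o i ∨ ∃ k l, k < l ∧ o k = o l ∧
      (∃ m, stepOK o i k m ∧ win n (Function.update o k m) i) ∧
      (∃ m, stepOK o i l m ∧ win n (Function.update o l m) i)
instance decWin : ∀ n o i, Decidable (win n o i)
  | 0, o, i => by unfold win; infer_instance
  | n+1, o, i => by
      have := decWin n
      unfold win; infer_instance

set_option maxRecDepth 100000 in
theorem win_start : ∀ p q r s : Fin 5, grp p ≠ grp q → grp r ≠ grp s →
    win 2 ![q,p,s,r] ![p,q,r,s] := by decide +kernel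
end FRR

namespace FRR
open Relation

variable {V : Type*}

theorem win_extract (Q : (Fin 4 → Fin 5) → Prop) (i : Fin 4 → Fin 5)
    (hQ : ∀ o k l, Q o → k ≠ l → o k = o l →
      (∀ m, (∀ j, o j ≠ m) → Q (Function.update o k m)) ∨
      (∀ m, (∀ j, o j ≠ m) → Q (Function.update o l m))) :
    ∀ n o, win n o i → Q o → ∃ o', Q o' ∧ finOK o' i := by
  intro n
  induction n with
  | zero => intro o h hq; exact ⟨o, hq, h⟩
  | succ n ih =>
    intro o h hq
    rcases h with h | ⟨k, l, hkl, hokl, ⟨m, hm, hw⟩, ⟨m', hm', hw'⟩⟩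
    · exact ⟨o, hq, h⟩
    · rcases hQ o k l hq hkl.ne hokl with h1 | h1
      · exact ih _ hw (h1 m hm.1)
      · exact ih _ hw' (h1 m' hm'.1)

/-- Coloured edges: endpoints `(u,v)`, colour of `u → v`, colour of `v → u`. -/
abbrev CE (V : Type*) := (V × V) × (Fin 5 × Fin 5)

def forget (e : CE V) : Sym2 V := s(e.1.1, e.1.2)

def arc (K : Multiset (CE V)) (c : Fin 5) (u v : V) : Prop :=
  ∃ q, ((u, v), (c, q)) ∈ K ∨ ((v, u), (q, c)) ∈ K

def GoodC (K : Multiset (CE V)) : Prop := ∀ e ∈ K, grp e.2.1 ≠ grp e.2.2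

def Rch (K : Multiset (CE V)) (c : Fin 5) (v t : V) : Prop := ReflTransGen (arc K c) v t

/-- The existence of a good colouring. -/
def Sol (S : Finset V) (M : Multiset (Sym2 V)) (t : V) : Prop :=
  ∃ K : Multiset (CE V), K.map forget = M ∧ GoodC K ∧ ∀ c, ∀ v ∈ S, Rch K c v t

theorem arc_cons {K : Multiset (CE V)} {c : Fin 5} {u v a b : V} {p q : Fin 5} :
    arc (((a, b), (p, q)) ::ₘ K) c u v ↔
      (u = a ∧ v = b ∧ c = p) ∨ (u = b ∧ v = a ∧ c = q) ∨ arc K c u v := by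
  unfold arc
  simp only [Multiset.mem_cons, Prod.mk.injEq]
  constructor
  · rintro ⟨r, (⟨⟨h1, h2⟩, h3, h4⟩ | h) | (⟨⟨h1, h2⟩, h3, h4⟩ | h)⟩
    · exact Or.inl ⟨h1, h2, h3⟩
    · exact Or.inr (Or.inr ⟨r, Or.inl h⟩)
    · exact Or.inr (Or.inl ⟨h2, h1, h4⟩)
    · exact Or.inr (Or.inr ⟨r, Or.inr h⟩)
  · rintro (⟨rfl, rfl, rfl⟩ | ⟨rfl, rfl, rfl⟩ | ⟨r, h⟩)
    · exact ⟨q, Or.inl (Or.inl ⟨⟨rfl, rfl⟩, rfl, rfl⟩)⟩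
    · exact ⟨p, Or.inr (Or.inl ⟨⟨rfl, rfl⟩, rfl, rfl⟩)⟩
    · exact ⟨r, h.imp Or.inr Or.inr⟩

theorem arc_add {K L : Multiset (CE V)} {c : Fin 5} {u v : V} :
    arc (K + L) c u v ↔ arc K c u v ∨ arc L c u v := by
  unfold arc
  simp only [Multiset.mem_add]
  constructor
  · rintro ⟨r, (h | h) | (h | h)⟩
    · exact Or.inl ⟨r, Or.inl h⟩
    · exact Or.inr ⟨r, Or.inl h⟩
    · exact Or.inl ⟨r, Or.inr h⟩
    · exact Or.inr ⟨r, Or.inr h⟩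
  · rintro (⟨r, h⟩ | ⟨r, h⟩)
    · exact ⟨r, h.imp Or.inl Or.inl⟩
    · exact ⟨r, h.imp Or.inr Or.inr⟩

/-- A coloured star at `z` with leaves `a`, out-colours `o`, in-colours `i`. -/
def stC (z : V) (a : Fin 4 → V) (o i : Fin 4 → Fin 5) : Multiset (CE V) :=
  (Finset.univ : Finset (Fin 4)).val.map fun k => ((z, a k), (o k, i k))

theorem arc_stC {z : V} {a : Fin 4 → V} {o i : Fin 4 → Fin 5} {c : Fin 5} {u v : V} :
    arc (stC z a o i) c u v ↔
      (∃ k, u = z ∧ v = a k ∧ c = o k) ∨ (∃ k, u = a k ∧ v = z ∧ c = i k) := by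
  unfold arc stC
  simp only [Multiset.mem_map, Finset.mem_val, Finset.mem_univ, true_and, Prod.mk.injEq]
  constructor
  · rintro ⟨r, ⟨k, ⟨h1, h2⟩, h3, h4⟩ | ⟨k, ⟨h1, h2⟩, h3, h4⟩⟩
    · exact Or.inl ⟨k, h1.symm, h2.symm, h3.symm⟩
    · exact Or.inr ⟨k, h2.symm, h1.symm, h4.symm⟩
  · rintro (⟨k, rfl, rfl, rfl⟩ | ⟨k, rfl, rfl, rfl⟩)
    · exact ⟨i k, Or.inl ⟨k, ⟨rfl, rfl⟩, rfl, rfl⟩⟩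
    · exact ⟨o k, Or.inr ⟨k, ⟨rfl, rfl⟩, rfl, rfl⟩⟩

/-- last exit from a set -/
theorem last_exit {R : V → V → Prop} {Z : V → Prop} {z t : V} (h : ReflTransGen R z t)
    (hz : Z z) (ht : ¬ Z t) :
    ∃ w b, Z w ∧ R w b ∧ ReflTransGen (fun u v => R u v ∧ ¬ Z u) b t := by
  have key : ∀ x, ReflTransGen R x t →
      ReflTransGen (fun u v => R u v ∧ ¬ Z u) x t ∨
      ∃ w b, Z w ∧ R w b ∧ ReflTransGen (fun u v => R u v ∧ ¬ Z u) b t := by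
    intro x hx
    induction hx using ReflTransGen.head_induction_on with
    | refl => exact Or.inl .refl
    | head h1 h2 ih =>
      rename_i x y
      rcases ih with ih | ih
      · by_cases hx : Z x
        · exact Or.inr ⟨x, y, hx, h1, ih⟩
        · exact Or.inl (ReflTransGen.head ⟨h1, hx⟩ ih)
      · exact Or.inr ih
  rcases key z h with h1 | h1
  · rcases ReflTransGen.cases_head h1 with rfl | ⟨b, h2, _⟩
    · exact absurd hz ht
    · exact absurd hz h2.2
  · exact h1

theorem reach_of_hit {R R' : V → V → Prop} {Z : V → Prop} {t : V}
    (hR : ∀ u v, R u v → R' u v ∨ Z u) (hZ : ∀ z, Z z → (∃ v, R z v) → ReflTransGen R' z t) :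
    ∀ v, ReflTransGen R v t → ReflTransGen R' v t := by
  intro v hv
  induction hv using ReflTransGen.head_induction_on with
  | refl => exact .refl
  | head h1 h2 ih =>
    rcases hR _ _ h1 with h | h
    · exact .head h ih
    · exact hZ _ h ⟨_, h1⟩

/-- Local state: everybody in `T` reaches `t` in all colours; `z` in the colours it emits. -/
def St (z : V) (a : Fin 4 → V) (i : Fin 4 → Fin 5) (K0 : Multiset (CE V)) (T : V → Fin 5 → Prop) (t : V)
    (o : Fin 4 → Fin 5) : Prop :=
  (∀ c v, T v c → Rch (stC z a o i + K0) c v t) ∧ ∀ k, Rch (stC z a o i + K0) (o k) z t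
end FRR

namespace FRR
open Relation

variable {V : Type*}

theorem rtg_mono {R R' : V → V → Prop} {a b : V} (h : ∀ u v, R u v → R' u v)
    (hp : ReflTransGen R a b) : ReflTransGen R' a b := by
  induction hp with
  | refl => exact .refl
  | tail _ h2 ih => exact ih.tail (h _ _ h2)

theorem St_free {z t : V} {a : Fin 4 → V} {i : Fin 4 → Fin 5} {K0 : Multiset (CE V)}
    {T : V → Fin 5 → Prop} {o : Fin 4 → Fin 5}
    (ha : ∀ k c, T (a k) c) (haz : ∀ k, a k ≠ z) (hz0 : ∀ c v, ¬ arc K0 c z v)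
    (h : St z a i K0 T t o) (k j : Fin 4) (hjk : j ≠ k) (hoj : o j = o k)
    (hpath : ReflTransGen (fun u v => arc (stC z a o i + K0) (o k) u v ∧ ¬ u = z) (a j) t)
    (m : Fin 5) (hm : ∀ j, o j ≠ m) : St z a i K0 T t (Function.update o k m) := by
  have hoff : ∀ c u v, u ≠ z → (arc (stC z a o i + K0) c u v →
      arc (stC z a (Function.update o k m) i + K0) c u v) := by
    intro c u v hu h
    rw [arc_add, arc_stC] at h ⊢
    rcases h with (⟨l, h, _⟩ | h) | h
    · exact absurd h hu
    · exact Or.inl (Or.inr h)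
    · exact Or.inr h
  have hzarc : ∀ l, arc (stC z a (Function.update o k m) i + K0)
      (Function.update o k m l) z (a l) := by
    intro l
    rw [arc_add, arc_stC]
    exact Or.inl (Or.inl ⟨l, rfl, rfl, rfl⟩)
  have hnoz : ∀ v, ¬ arc (stC z a o i + K0) m z v := by
    intro v h
    rw [arc_add, arc_stC] at h
    rcases h with (⟨l, _, _, h⟩ | ⟨l, h, _⟩) | h
    · exact hm l h.symm
    · exact haz l h.symm
    · exact hz0 _ _ h
  have hzj : Rch (stC z a (Function.update o k m) i + K0) (o k) z t := by
    have h1 := hzarc j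
    rw [Function.update_of_ne hjk, hoj] at h1
    refine ReflTransGen.head h1 (rtg_mono ?_ hpath)
    rintro u v ⟨h2, h3⟩
    exact hoff _ _ _ h3 h2
  have hz : ∀ l, Rch (stC z a (Function.update o k m) i + K0) (Function.update o k m l) z t := by
    intro l
    by_cases hlk : l = k
    · subst hlk
      refine ReflTransGen.head (hzarc l) ?_
      rw [Function.update_self]
      refine rtg_mono ?_ (h.1 m (a l) (ha l m))
      intro u v h2
      refine hoff _ _ _ ?_ h2
      rintro rfl
      exact hnoz _ h2
    · rw [Function.update_of_ne hlk]
      by_cases hc : o l = o k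
      · rw [hc]; exact hzj
      · refine rtg_mono ?_ (h.2 l)
        intro u v h2
        by_cases hu : u = z
        · subst hu
          rw [arc_add, arc_stC] at h2
          rcases h2 with (⟨l', _, rfl, h3⟩ | ⟨l', h3, _⟩) | h3
          · have : l' ≠ k := by rintro rfl; exact hc h3
            have h4 := hzarc l'
            rw [Function.update_of_ne this, ← h3] at h4
            exact h4
          · exact absurd h3.symm (haz _)
          · exact absurd h3 (hz0 _ _)
        · exact hoff _ _ _ hu h2
  refine ⟨?_, hz⟩
  intro c v hv
  refine reach_of_hit (Z := fun u => u = z) ?_ ?_ v (h.1 c v hv)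
  · intro u v h2
    by_cases hu : u = z
    · exact Or.inr hu
    · exact Or.inl (hoff _ _ _ hu h2)
  · rintro u rfl ⟨v, h2⟩
    rw [arc_add, arc_stC] at h2
    rcases h2 with (⟨l', _, rfl, h3⟩ | ⟨l', h3, _⟩) | h3
    · by_cases hlk : l' = k
      · rw [h3, hlk]; exact hzj
      · have := hz l'
        rw [Function.update_of_ne hlk] at this
        rw [h3]; exact this
    · exact absurd h3.symm (haz _)
    · exact absurd h3 (hz0 _ _)

theorem St_step {z t : V} {a : Fin 4 → V} {i : Fin 4 → Fin 5} {K0 : Multiset (CE V)}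
    {T : V → Fin 5 → Prop} {o : Fin 4 → Fin 5} (hzt : z ≠ t)
    (ha : ∀ k c, T (a k) c) (haz : ∀ k, a k ≠ z) (hz0 : ∀ c v, ¬ arc K0 c z v)
    (k l : Fin 4) (h : St z a i K0 T t o) (hkl : k ≠ l) (hokl : o k = o l) :
      (∀ m, (∀ j, o j ≠ m) → St z a i K0 T t (Function.update o k m)) ∨
      (∀ m, (∀ j, o j ≠ m) → St z a i K0 T t (Function.update o l m)) := by
  obtain ⟨w, b, rfl, h1, h2⟩ := last_exit (Z := fun u => u = z) (h.2 k) rfl hzt.symm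
  rw [arc_add, arc_stC] at h1
  rcases h1 with (⟨j, _, rfl, h3⟩ | ⟨l', h3, _⟩) | h3
  · by_cases hjk : j = k
    · right
      subst hjk
      intro m hm
      exact St_free ha haz hz0 h l j hkl hokl (by rw [← hokl]; exact h2) m hm
    · left
      intro m hm
      exact St_free ha haz hz0 h k j hjk h3.symm h2 m hm
  · exact absurd h3.symm (haz _)
  · exact absurd h3 (hz0 _ _)

/-- The V-lemma. -/
theorem St_final {z t : V} {a : Fin 4 → V} {K0 : Multiset (CE V)}
    {T : V → Fin 5 → Prop} {p q r s : Fin 5} (hzt : z ≠ t)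
    (ha : ∀ k c, T (a k) c) (haz : ∀ k, a k ≠ z) (hz0 : ∀ c v, ¬ arc K0 c z v)
    (hpq : grp p ≠ grp q) (hrs : grp r ≠ grp s)
    (h : St z a ![p, q, r, s] K0 T t ![q, p, s, r]) :
    ∃ o, St z a ![p, q, r, s] K0 T t o ∧ finOK o ![p, q, r, s] :=
  win_extract (St z a ![p, q, r, s] K0 T t) _
    (fun _ k l h hkl hokl => St_step hzt ha haz hz0 k l h hkl hokl) 2 _
    (win_start p q r s hpq hrs) h

theorem stC_four (z : V) (a : Fin 4 → V) (o i : Fin 4 → Fin 5) :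
    stC z a o i = ((z, a 0), (o 0, i 0)) ::ₘ ((z, a 1), (o 1, i 1)) ::ₘ
      ((z, a 2), (o 2, i 2)) ::ₘ ((z, a 3), (o 3, i 3)) ::ₘ 0 := by
  rfl

/-- Pinching two edges. -/
theorem pinch_reach {z t : V} {u₁ u₂ u₃ u₄ : V} {p q r s : Fin 5} {K0 : Multiset (CE V)}
    {c : Fin 5} {v : V}
    (h : Rch (((u₁, u₂), (p, q)) ::ₘ ((u₃, u₄), (r, s)) ::ₘ K0) c v t) :
    Rch (stC z ![u₁, u₂, u₃, u₄] ![q, p, s, r] ![p, q, r, s] + K0) c v t := by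
  unfold Rch at *
  induction h using ReflTransGen.head_induction_on with
  | refl => exact .refl
  | head h1 h2 ih =>
    rw [arc_cons, arc_cons] at h1
    have harc : ∀ k : Fin 4, ∀ c', c' = ![p, q, r, s] k →
        arc (stC z ![u₁, u₂, u₃, u₄] ![q, p, s, r] ![p, q, r, s] + K0) c'
        (![u₁, u₂, u₃, u₄] k) z := by
      intro k c' hc
      rw [arc_add, arc_stC]
      exact Or.inl (Or.inr ⟨k, rfl, rfl, hc⟩)
    have harc' : ∀ k : Fin 4, ∀ c', c' = ![q, p, s, r] k →
        arc (stC z ![u₁, u₂, u₃, u₄] ![q, p, s, r] ![p, q, r, s] + K0) c'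
        z (![u₁, u₂, u₃, u₄] k) := by
      intro k c' hc
      rw [arc_add, arc_stC]
      exact Or.inl (Or.inl ⟨k, rfl, rfl, hc⟩)
    rcases h1 with ⟨rfl, rfl, hc⟩ | ⟨rfl, rfl, hc⟩ | ⟨rfl, rfl, hc⟩ | ⟨rfl, rfl, hc⟩ | h1
    · exact .head (harc 0 _ hc) (.head (harc' 1 _ hc) ih)
    · exact .head (harc 1 _ hc) (.head (harc' 0 _ hc) ih)
    · exact .head (harc 2 _ hc) (.head (harc' 3 _ hc) ih)
    · exact .head (harc 3 _ hc) (.head (harc' 2 _ hc) ih)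
    · exact .head (arc_add.2 (Or.inr h1)) ih

theorem pinch_St {z t : V} {u₁ u₂ u₃ u₄ : V} {p q r s : Fin 5} {K0 : Multiset (CE V)}
    {T : V → Fin 5 → Prop}
    (h : ∀ c v, T v c → Rch (((u₁, u₂), (p, q)) ::ₘ ((u₃, u₄), (r, s)) ::ₘ K0) c v t)
    (ha : ∀ k c, T (![u₁, u₂, u₃, u₄] k) c) :
    St z ![u₁, u₂, u₃, u₄] ![p, q, r, s] K0 T t ![q, p, s, r] := by
  refine ⟨fun c v hv => pinch_reach (h c v hv), fun k => ?_⟩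
  refine ReflTransGen.head ?_ (pinch_reach (h _ _ (ha k _)))
  rw [arc_add, arc_stC]
  exact Or.inl (Or.inl ⟨k, rfl, rfl, rfl⟩)
end FRR

namespace FRR
open Relation

variable {V : Type*}

theorem arc_mem {K : Multiset (CE V)} {c : Fin 5} {u v : V} (h : arc K c u v) :
    s(u, v) ∈ K.map forget := by
  obtain ⟨q, h | h⟩ := h
  · exact Multiset.mem_map.2 ⟨_, h, rfl⟩
  · exact Multiset.mem_map.2 ⟨_, h, Sym2.eq_swap⟩

theorem Rch_congr {K L : Multiset (CE V)} (h : ∀ c u v, arc K c u v → arc L c u v)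
    {c : Fin 5} {v t : V} (hr : Rch K c v t) : Rch L c v t :=
  rtg_mono (h c) hr

theorem uncons {K : Multiset (CE V)} {a b : V} {M : Multiset (Sym2 V)}
    (h : K.map forget = s(a, b) ::ₘ M) (hg : GoodC K) :
    ∃ p q K0, K0.map forget = M ∧ GoodC K0 ∧ grp p ≠ grp q ∧
      ∀ c u v, arc K c u v ↔ arc (((a, b), (p, q)) ::ₘ K0) c u v := by
  have h1 : s(a, b) ∈ K.map forget := by rw [h]; exact Multiset.mem_cons_self _ _
  obtain ⟨⟨⟨x, y⟩, ⟨p, q⟩⟩, he, hf⟩ := Multiset.mem_map.1 h1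
  obtain ⟨K0, rfl⟩ := Multiset.exists_cons_of_mem he
  rw [Multiset.map_cons, hf, Multiset.cons_inj_right] at h
  have hg0 : GoodC K0 := fun e he => hg e (Multiset.mem_cons_of_mem he)
  have hpq : grp p ≠ grp q := hg _ (Multiset.mem_cons_self _ _)
  simp only [forget, Sym2.eq_iff] at hf
  rcases hf with ⟨rfl, rfl⟩ | ⟨rfl, rfl⟩
  · exact ⟨p, q, K0, h, hg0, hpq, fun _ _ _ => Iff.rfl⟩
  · refine ⟨q, p, K0, h, hg0, hpq.symm, fun c u v => ?_⟩
    rw [arc_cons, arc_cons]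
    tauto

theorem GoodC_cons {K : Multiset (CE V)} {a b : V} {p q : Fin 5} (h : grp p ≠ grp q)
    (hK : GoodC K) : GoodC (((a, b), (p, q)) ::ₘ K) := by
  intro e he
  rcases Multiset.mem_cons.1 he with rfl | he
  · exact h
  · exact hK e he

theorem GoodC_add {K L : Multiset (CE V)} (hL : GoodC L)
    (hK : GoodC K) : GoodC (L + K) := by
  intro e he
  rcases Multiset.mem_add.1 he with he | he
  · exact hL e he
  · exact hK e he

theorem GoodC_stC {z : V} {a : Fin 4 → V} {o i : Fin 4 → Fin 5}
    (h : ∀ k, grp (o k) ≠ grp (i k)) : GoodC (stC z a o i) := by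
  intro e he
  obtain ⟨k, _, rfl⟩ := Multiset.mem_map.1 he
  exact h k

/-- Uncoloured star. -/
def star4 (z : V) (a : Fin 4 → V) : Multiset (Sym2 V) :=
  (Finset.univ : Finset (Fin 4)).val.map fun k => s(z, a k)

theorem stC_forget {z : V} {a : Fin 4 → V} {o i : Fin 4 → Fin 5} :
    (stC z a o i).map forget = star4 z a := by
  unfold stC star4
  rw [Multiset.map_map]
  rfl

theorem miss (o : Fin 4 → Fin 5) (ho : ∀ k l, o k = o l → k = l) :
    ∃ m, (∀ k, o k ≠ m) ∧ ∀ c, c ≠ m → ∃ k, o k = c := by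
  have hc : (Finset.univ.image o).card = 4 := by
    rw [Finset.card_image_of_injective _ (fun k l h => ho k l h)]; rfl
  have hc' : (Finset.univ.image o)ᶜ.card = 1 := by
    rw [Finset.card_compl, hc]; rfl
  obtain ⟨m, hm⟩ := Finset.card_eq_one.1 hc'
  refine ⟨m, fun k hk => ?_, fun c hcm => ?_⟩
  · have : m ∈ (Finset.univ.image o)ᶜ := by rw [hm]; simp
    rw [Finset.mem_compl] at this
    exact this (Finset.mem_image.2 ⟨k, Finset.mem_univ _, hk⟩)
  · by_contra hcon
    have : c ∈ (Finset.univ.image o)ᶜ := by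
      rw [Finset.mem_compl, Finset.mem_image]
      rintro ⟨k, _, hk⟩
      exact hcon ⟨k, hk⟩
    rw [hm, Finset.mem_singleton] at this
    exact hcm this

theorem other_grp : ∀ m : Fin 5, ∃ m' : Fin 5, grp m ≠ grp m' := by decide

theorem Sol_cons {S : Finset V} {M : Multiset (Sym2 V)} {t : V} (e : Sym2 V)
    (h : Sol S M t) : Sol S (e ::ₘ M) t := by
  obtain ⟨K, hK, hg, hr⟩ := h
  induction e with | _ a b
  refine ⟨((a, b), (0, 1)) ::ₘ K, ?_, GoodC_cons (by decide) hg, fun c v hv => ?_⟩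
  · rw [Multiset.map_cons, hK]; rfl
  · exact Rch_congr (fun c u v h => arc_cons.2 (Or.inr (Or.inr h))) (hr c v hv)

theorem op2_color [DecidableEq V] {S : Finset V} {z w t : V} {a : Fin 4 → V}
    {M0 : Multiset (Sym2 V)} (hzt : z ≠ t) (ha : ∀ k, a k ∈ S.erase z) (hw : w ∈ S.erase z)
    (hz0 : ∀ e ∈ M0, z ∉ e)
    (h : Sol (S.erase z) (s(a 0, a 1) ::ₘ s(a 2, a 3) ::ₘ M0) t) :
    Sol S (s(z, w) ::ₘ (star4 z a + M0)) t := by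
  obtain ⟨K, hK, hg, hr⟩ := h
  obtain ⟨p, q, K1, hK1, hg1, hpq, harc1⟩ := uncons hK hg
  obtain ⟨r, s, K0, hK0, hg0, hrs, harc0⟩ := uncons hK1 hg1
  have hz0' : ∀ c v, ¬ arc K0 c z v := by
    intro c v h
    have := arc_mem h
    rw [hK0] at this
    exact hz0 _ this (Sym2.mem_mk_left _ _)
  have haa : a = ![a 0, a 1, a 2, a 3] := by ext k; fin_cases k <;> rfl
  have hst : St z a ![p, q, r, s] K0 (fun v _ => v ∈ S.erase z) t ![q, p, s, r] := by
    rw [haa]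
    apply pinch_St
    · intro c v hv
      refine Rch_congr ?_ (hr c v hv)
      intro c u v h
      rw [harc1, arc_cons, harc0] at h
      rw [arc_cons]; exact h
    · rw [← haa]; exact fun k _ => ha k
  obtain ⟨o, ho, hf⟩ := St_final hzt (fun k _ => ha k) (fun k => Finset.ne_of_mem_erase (ha k))
    hz0' hpq hrs hst
  obtain ⟨m, hm, hm'⟩ := miss o hf.1
  obtain ⟨m', hmm⟩ := other_grp m
  have hmono : ∀ c u v, arc (stC z a o ![p, q, r, s] + K0) c u v →
    arc (((z, w), (m, m')) ::ₘ (stC z a o ![p, q, r, s] + K0)) c u v :=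
      fun c u v h => arc_cons.2 (Or.inr (Or.inr h))
  refine ⟨((z, w), (m, m')) ::ₘ (stC z a o ![p, q, r, s] + K0), ?_, ?_, ?_⟩
  · rw [Multiset.map_cons, Multiset.map_add, stC_forget, hK0]; rfl
  · exact GoodC_cons hmm (GoodC_add (GoodC_stC hf.2.1) hg0)
  · intro c v hv
    by_cases hvz : v = z
    · subst hvz
      by_cases hc : c = m
      · subst hc
        refine ReflTransGen.head (arc_cons.2 (Or.inl ⟨rfl, rfl, rfl⟩)) ?_
        exact Rch_congr hmono (ho.1 _ w hw)
      · obtain ⟨k, rfl⟩ := hm' c hc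
        exact Rch_congr hmono (ho.2 k)
    · exact Rch_congr hmono (ho.1 _ v (Finset.mem_erase.2 ⟨hvz, hv⟩))

theorem choose_x {o1 i1 o2 i2 : Fin 4 → Fin 5} {m1 m2 : Fin 5} (h1 : finOK o1 i1)
    (h2 : finOK o2 i2) (hm1 : ∀ k, o1 k ≠ m1) (hm1' : ∀ c, c ≠ m1 → ∃ k, o1 k = c)
    (hm2 : ∀ k, o2 k ≠ m2) (hm2' : ∀ c, c ≠ m2 → ∃ k, o2 k = c) (hm : grp m1 = grp m2) :
    ∃ k1 k2, o1 k1 = o2 k2 ∧ grp (o1 k1) ≠ grp m1 ∧ grp (i1 k1) ≠ grp m1 ∧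
      grp (i2 k2) ≠ grp m2 := by
  have hc : 3 ≤ (Finset.univ.filter fun x : Fin 5 => grp x ≠ grp m1).card := by
    revert m1; intro m1 _ _ _; clear * -; revert m1; decide
  have hbad : ∀ (o i : Fin 4 → Fin 5) m, finOK o i → (∀ k, o k ≠ m) →
      (Finset.univ.filter fun x : Fin 5 => ∃ k, o k = x ∧ grp (i k) = grp m).card ≤ 1 := by
    intro o i m h hm
    rw [Finset.card_le_one]
    intro x hx y hy
    simp only [Finset.mem_filter, Finset.mem_univ, true_and] at hx hy
    obtain ⟨k, rfl, hk⟩ := hx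
    obtain ⟨l, rfl, hl⟩ := hy
    rw [h.2.2 m hm k l hk hl]
  have : ∃ x ∈ (Finset.univ.filter fun x : Fin 5 => grp x ≠ grp m1),
      x ∉ (Finset.univ.filter fun x : Fin 5 => ∃ k, o1 k = x ∧ grp (i1 k) = grp m1) ∪
      (Finset.univ.filter fun x : Fin 5 => ∃ k, o2 k = x ∧ grp (i2 k) = grp m2) := by
    apply Finset.exists_mem_notMem_of_card_lt_card
    refine lt_of_le_of_lt (Finset.card_union_le _ _) ?_
    have := hbad o1 i1 m1 h1 hm1
    have := hbad o2 i2 m2 h2 hm2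
    omega
  obtain ⟨x, hx, hx'⟩ := this
  simp only [Finset.mem_union, Finset.mem_filter, Finset.mem_univ, true_and, not_or,
    not_exists, not_and] at hx hx'
  obtain ⟨k1, hk1⟩ := hm1' x (by rintro rfl; exact hx rfl)
  obtain ⟨k2, hk2⟩ := hm2' x (by rintro rfl; exact hx hm.symm)
  exact ⟨k1, k2, by rw [hk1, hk2], by rw [hk1]; exact hx, hx'.1 k1 hk1, hx'.2 k2 hk2⟩

theorem sym_case [DecidableEq V] {S : Finset V} {z1 z2 t : V} {a b : Fin 4 → V}
    {o1 i1 o2 i2 : Fin 4 → Fin 5} {m1 m2 : Fin 5} {K0 : Multiset (CE V)} (h12 : z1 ≠ z2)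
    (hb : ∀ k, b k ∈ S ∧ b k ≠ z1 ∧ b k ≠ z2)
    (hz2a : ∀ k, a k ≠ z2)
    (hz0 : ∀ c v, ¬ arc K0 c z2 v) (hgK : GoodC K0)
    (h1 : finOK o1 i1) (h2 : finOK o2 i2) 
    (hm1' : ∀ c, c ≠ m1 → ∃ k, o1 k = c)
    (hm2 : ∀ k, o2 k ≠ m2) (hm2' : ∀ c, c ≠ m2 → ∃ k, o2 k = c) 
    {k1 k2 : Fin 4} (hk : o1 k1 = o2 k2) (hg : grp (o1 k1) ≠ grp m1)
    (hg2 : grp (i2 k2) ≠ grp m2)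
    (hT : ∀ c, ∀ v ∈ S, v ≠ z1 → v ≠ z2 → Rch (stC z2 b o2 i2 + (stC z1 a o1 i1 + K0)) c v t)
    (hr1 : ∀ k, Rch (stC z2 b o2 i2 + (stC z1 a o1 i1 + K0)) (o1 k) z1 t)
    (hr2 : ∀ k, Rch (stC z2 b o2 i2 + (stC z1 a o1 i1 + K0)) (o2 k) z2 t)
    {y : V} (hy : arc (stC z2 b o2 i2 + (stC z1 a o1 i1 + K0)) (o1 k1) z1 y)
    (hp : ReflTransGen (fun u v => arc (stC z2 b o2 i2 + (stC z1 a o1 i1 + K0)) (o1 k1) u v ∧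
      ¬ (u = z1 ∨ u = z2)) y t) :
    Sol S (s(z2, z1) ::ₘ (star4 z2 b + (star4 z1 a + K0.map forget))) t := by
  set H := stC z2 b o2 i2 + (stC z1 a o1 i1 + K0) with hH
  set H' := ((z2, z1), (o1 k1, m1)) ::ₘ (stC z2 b (Function.update o2 k2 m2) i2 +
    (stC z1 a o1 i1 + K0)) with hH'
  have hoff : ∀ c u v, u ≠ z2 → arc H c u v → arc H' c u v := by
    intro c u v hu h
    rw [hH, arc_add, arc_stC] at h
    rw [hH', arc_cons, arc_add, arc_stC]
    rcases h with (⟨l, h, _⟩ | h) | h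
    · exact absurd h hu
    · exact Or.inr (Or.inr (Or.inl (Or.inr h)))
    · exact Or.inr (Or.inr (Or.inr h))
  have hz2arc : ∀ c v, arc H c z2 v → ∃ l, v = b l ∧ c = o2 l := by
    intro c v h
    rw [hH, arc_add, arc_stC, arc_add, arc_stC] at h
    rcases h with (⟨l, _, h, h'⟩ | ⟨l, h, _⟩) | (⟨l, h, _⟩ | ⟨l, h, _⟩) | h
    · exact ⟨l, h, h'⟩
    · exact absurd h.symm (hb l).2.2
    · exact absurd h.symm h12
    · exact absurd h.symm (hz2a l)
    · exact absurd h (hz0 _ _)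
  have hlink1 : arc H' (o1 k1) z2 z1 := arc_cons.2 (Or.inl ⟨rfl, rfl, rfl⟩)
  have hlink2 : arc H' m1 z1 z2 := arc_cons.2 (Or.inr (Or.inl ⟨rfl, rfl, rfl⟩))
  have hnew : ∀ l, arc H' (Function.update o2 k2 m2 l) z2 (b l) := by
    intro l
    rw [hH', arc_cons, arc_add, arc_stC]
    exact Or.inr (Or.inr (Or.inl (Or.inl ⟨l, rfl, rfl, rfl⟩)))
  have hx1 : Rch H' (o1 k1) z1 t := by
    refine .head (hoff _ _ _ h12 hy) (rtg_mono ?_ hp)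
    rintro u v ⟨h, h'⟩
    exact hoff _ _ _ (fun h => h' (Or.inr h)) h
  have hx2 : Rch H' (o1 k1) z2 t := .head hlink1 hx1
  have hmono : ∀ c v, Rch H c v t → Rch H' c v t := by
    intro c v h
    by_cases hc : c = o1 k1
    · subst hc
      refine reach_of_hit (Z := fun u => u = z2) ?_ ?_ v h
      · intro u v h2
        by_cases hu : u = z2
        · exact Or.inr hu
        · exact Or.inl (hoff _ _ _ hu h2)
      · rintro u rfl _
        exact hx2
    · refine rtg_mono ?_ h
      intro u v h2
      by_cases hu : u = z2
      · subst hu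
        obtain ⟨l, rfl, rfl⟩ := hz2arc _ _ h2
        have := hnew l
        rwa [Function.update_of_ne (by rintro rfl; exact hc hk.symm)] at this
      · exact hoff _ _ _ hu h2
  have hz2 : ∀ c, Rch H' c z2 t := by
    intro c
    by_cases hc : c = m2
    · subst hc
      have := hnew k2
      rw [Function.update_self] at this
      exact .head this (hmono _ _ (hT _ _ (hb k2).1 (hb k2).2.1 (hb k2).2.2))
    · obtain ⟨k, rfl⟩ := hm2' c hc
      exact hmono _ _ (hr2 k)
  refine ⟨H', ?_, ?_, ?_⟩
  · rw [hH', Multiset.map_cons, Multiset.map_add, Multiset.map_add, stC_forget, stC_forget]; rfl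
  · refine GoodC_cons hg (GoodC_add (GoodC_stC ?_) (GoodC_add (GoodC_stC h1.2.1) hgK))
    intro k
    by_cases hkk : k = k2
    · subst hkk; rw [Function.update_self]; exact hg2.symm
    · rw [Function.update_of_ne hkk]; exact h2.2.1 k
  · intro c v hv
    by_cases hv2 : v = z2
    · subst hv2; exact hz2 c
    by_cases hv1 : v = z1
    · subst hv1
      by_cases hc : c = m1
      · subst hc
        exact .head hlink2 (hz2 _)
      · obtain ⟨k, rfl⟩ := hm1' c hc
        exact hmono _ _ (hr1 k)
    · exact hmono _ _ (hT c v hv hv1 hv2)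

theorem op3_color [DecidableEq V] {S : Finset V} {z1 z2 t : V} {a b : Fin 4 → V}
    {M0 : Multiset (Sym2 V)} (h12 : z1 ≠ z2) (hz1t : z1 ≠ t) (hz2t : z2 ≠ t)
    (ha : ∀ k, a k ∈ (S.erase z1).erase z2) (hb : ∀ k, b k ∈ (S.erase z1).erase z2)
    (hz10 : ∀ e ∈ M0, z1 ∉ e) (hz20 : ∀ e ∈ M0, z2 ∉ e)
    (h : Sol ((S.erase z1).erase z2) (s(a 0, a 1) ::ₘ s(a 2, a 3) ::ₘ
      s(b 0, b 1) ::ₘ s(b 2, b 3) ::ₘ M0) t) :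
    Sol S (s(z1, z2) ::ₘ (star4 z1 a + (star4 z2 b + M0))) t := by
  obtain ⟨K, hK, hg, hr⟩ := h
  obtain ⟨p, q, K1, hK1, hg1, hpq, harc1⟩ := uncons hK hg
  obtain ⟨r, s, K2, hK2, hg2, hrs, harc2⟩ := uncons hK1 hg1
  obtain ⟨p', q', K3, hK3, hg3, hpq', harc3⟩ := uncons hK2 hg2
  obtain ⟨r', s', K0, hK0, hg0, hrs', harc0⟩ := uncons hK3 hg3
  simp only [Finset.mem_erase] at ha hb
  have hz10' : ∀ c v, ¬ arc K0 c z1 v := by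
    intro c v h
    have := arc_mem h
    rw [hK0] at this
    exact hz10 _ this (Sym2.mem_mk_left _ _)
  have hz20' : ∀ c v, ¬ arc K0 c z2 v := by
    intro c v h
    have := arc_mem h
    rw [hK0] at this
    exact hz20 _ this (Sym2.mem_mk_left _ _)
  have haa : a = ![a 0, a 1, a 2, a 3] := by ext k; fin_cases k <;> rfl
  have hbb : b = ![b 0, b 1, b 2, b 3] := by ext k; fin_cases k <;> rfl
  set T : V → Fin 5 → Prop := fun v _ => v ∈ (S.erase z1).erase z2 with hT
  have hst : St z1 a ![p, q, r, s] (((b 0, b 1), (p', q')) ::ₘ ((b 2, b 3), (r', s')) ::ₘ K0)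
      T t ![q, p, s, r] := by
    rw [haa]
    apply pinch_St
    · intro c v hv
      refine Rch_congr ?_ (hr c v hv)
      intro c u v h
      rw [harc1, arc_cons, harc2, arc_cons, harc3, arc_cons, harc0] at h
      rw [arc_cons, arc_cons, arc_cons]; exact h
    · rw [← haa]; intro k c; simp only [hT, Finset.mem_erase]; exact ha k
  obtain ⟨o1, ho1, hf1⟩ := St_final hz1t
    (by intro k c; simp only [hT, Finset.mem_erase]; exact ha k) (fun k => (ha k).2.1)
    (by
      intro c v h
      rw [arc_cons, arc_cons] at h
      rcases h with ⟨h, _⟩ | ⟨h, _⟩ | ⟨h, _⟩ | ⟨h, _⟩ | h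
      · exact (hb _).2.1 h.symm
      · exact (hb _).2.1 h.symm
      · exact (hb _).2.1 h.symm
      · exact (hb _).2.1 h.symm
      · exact hz10' _ _ h) hpq hrs hst
  set T' : V → Fin 5 → Prop := fun v c => v ∈ (S.erase z1).erase z2 ∨ (v = z1 ∧ ∃ k, c = o1 k)
    with hT'
  have hst2 : St z2 b ![p', q', r', s'] (stC z1 a o1 ![p, q, r, s] + K0)
      T' t ![q', p', s', r'] := by
    rw [hbb]
    apply pinch_St
    · have hc : ∀ c v, Rch (stC z1 a o1 ![p, q, r, s] +
          (((b 0, b 1), (p', q')) ::ₘ ((b 2, b 3), (r', s')) ::ₘ K0)) c v t →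
          Rch (((b 0, b 1), (p', q')) ::ₘ ((b 2, b 3), (r', s')) ::ₘ
            (stC z1 a o1 ![p, q, r, s] + K0)) c v t := by
        intro c v
        apply Rch_congr
        intro c u v h
        rw [arc_add, arc_cons, arc_cons] at h
        rw [arc_cons, arc_cons, arc_add]
        rcases h with h | h | h | h | h | h
        · exact Or.inr (Or.inr (Or.inr (Or.inr (Or.inl h))))
        · exact Or.inl h
        · exact Or.inr (Or.inl h)
        · exact Or.inr (Or.inr (Or.inl h))
        · exact Or.inr (Or.inr (Or.inr (Or.inl h)))
        · exact Or.inr (Or.inr (Or.inr (Or.inr (Or.inr h))))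
      rintro c v (hv | ⟨rfl, k, rfl⟩)
      · exact hc _ _ (ho1.1 c v hv)
      · exact hc _ _ (ho1.2 k)
    · rw [← hbb]; intro k c; left; simp only [Finset.mem_erase]; exact hb k
  obtain ⟨o2, ho2, hf2⟩ := St_final hz2t
    (by intro k c; left; simp only [Finset.mem_erase]; exact hb k) (fun k => (hb k).1)
    (by
      intro c v h
      rw [arc_add, arc_stC] at h
      rcases h with (⟨k, h, _⟩ | ⟨k, h, _⟩) | h
      · exact h12 h.symm
      · exact (ha _).1 h.symm
      · exact hz20' _ _ h) hpq' hrs' hst2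
  obtain ⟨m1, hm1, hm1'⟩ := miss o1 hf1.1
  obtain ⟨m2, hm2, hm2'⟩ := miss o2 hf2.1
  generalize ![p, q, r, s] = i1 at *
  generalize ![p', q', r', s'] = i2 at *
  have hTr : ∀ c, ∀ v ∈ S, v ≠ z1 → v ≠ z2 →
      Rch (stC z2 b o2 i2 + (stC z1 a o1 i1 + K0)) c v t := by
    intro c v hv h1 h2
    exact ho2.1 c v (Or.inl (by simp only [Finset.mem_erase]; exact ⟨h2, h1, hv⟩))
  have hr1 : ∀ k, Rch (stC z2 b o2 i2 + (stC z1 a o1 i1 + K0)) (o1 k) z1 t :=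
    fun k => ho2.1 _ _ (Or.inr ⟨rfl, k, rfl⟩)
  have hr2 := ho2.2
  have hcomm : stC z2 b o2 i2 + (stC z1 a o1 i1 + K0) = stC z1 a o1 i1 + (stC z2 b o2 i2 + K0) :=
    add_left_comm _ _ _
  by_cases hgm : grp m1 = grp m2
  · obtain ⟨k1, k2, hk, hx, hx1, hx2⟩ := choose_x hf1 hf2 hm1 hm1' hm2 hm2' hgm
    obtain ⟨w, y, hw, hwy, hp⟩ := last_exit (Z := fun u => u = z1 ∨ u = z2) (hr1 k1) (Or.inl rfl)
      (by rintro (h | h); exacts [hz1t h.symm, hz2t h.symm])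
    rcases hw with rfl | rfl
    · have := sym_case h12 (fun k => ⟨(hb k).2.2, (hb k).2.1, (hb k).1⟩) (fun k => (ha k).1)
        hz20' hg0 hf1 hf2 hm1' hm2 hm2' hk hx hx2 hTr hr1 hr2 hwy hp
      rw [hK0, Sym2.eq_swap, add_left_comm] at this
      exact this
    · rw [hcomm] at hTr hr1 hr2 hwy hp
      have := sym_case h12.symm (fun k => ⟨(ha k).2.2, (ha k).1, (ha k).2.1⟩)
        (fun k => (hb k).2.1)
        hz10' hg0 hf2 hf1 hm2' hm1 hm1' hk.symm (by rw [← hk, ← hgm]; exact hx) hx1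
        (fun c v hv h1 h2 => hTr c v hv h2 h1) hr2 hr1 (by rw [← hk]; exact hwy)
        (by
          rw [← hk]
          exact rtg_mono (fun u v h => ⟨h.1, fun h' => h.2 h'.symm⟩) hp)
      rw [hK0] at this
      exact this
  · have hmono : ∀ c u v, arc (stC z2 b o2 i2 + (stC z1 a o1 i1 + K0)) c u v →
      arc (((z1, z2), (m1, m2)) ::ₘ (stC z2 b o2 i2 + (stC z1 a o1 i1 + K0))) c u v :=
        fun c u v h => arc_cons.2 (Or.inr (Or.inr h))
    refine ⟨((z1, z2), (m1, m2)) ::ₘ (stC z2 b o2 i2 + (stC z1 a o1 i1 + K0)), ?_, ?_, ?_⟩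
    · rw [Multiset.map_cons, Multiset.map_add, Multiset.map_add, stC_forget, stC_forget, hK0,
        add_left_comm]; rfl
    · exact GoodC_cons hgm (GoodC_add (GoodC_stC hf2.2.1) (GoodC_add (GoodC_stC hf1.2.1) hg0))
    · intro c v hv
      have hmm : m1 ≠ m2 := fun h => hgm (by rw [h])
      by_cases hv1 : v = z1
      · subst hv1
        by_cases hc : c = m1
        · subst hc
          obtain ⟨k, hk⟩ := hm2' c hmm
          have h2 := hr2 k
          rw [hk] at h2
          exact .head (arc_cons.2 (Or.inl ⟨rfl, rfl, rfl⟩)) (Rch_congr hmono h2)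
        · obtain ⟨k, rfl⟩ := hm1' c hc
          exact Rch_congr hmono (hr1 k)
      by_cases hv2 : v = z2
      · subst hv2
        by_cases hc : c = m2
        · subst hc
          obtain ⟨k, hk⟩ := hm1' c hmm.symm
          have h2 := hr1 k
          rw [hk] at h2
          exact .head (arc_cons.2 (Or.inr (Or.inl ⟨rfl, rfl, rfl⟩))) (Rch_congr hmono h2)
        · obtain ⟨k, rfl⟩ := hm2' c hc
          exact Rch_congr hmono (hr2 k)
      exact Rch_congr hmono (hTr c v hv hv1 hv2)
end FRR

namespace FRR
open Relation

variable {V : Type*}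

def fam {V : Type*} (f : Fin 5 → CE V) : Multiset (CE V) := (Finset.univ : Finset (Fin 5)).val.map f
def famE {V : Type*} (f : Fin 5 → Sym2 V) : Multiset (Sym2 V) := (Finset.univ : Finset (Fin 5)).val.map f

theorem arc_fam {f g : Fin 5 → V} {p q : Fin 5 → Fin 5} {c : Fin 5} {u v : V} :
    arc (fam fun j => ((f j, g j), (p j, q j))) c u v ↔
      (∃ k, u = f k ∧ v = g k ∧ c = p k) ∨ (∃ k, u = g k ∧ v = f k ∧ c = q k) := by
  unfold arc fam
  simp only [Multiset.mem_map, Finset.mem_val, Finset.mem_univ, true_and, Prod.mk.injEq]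
  constructor
  · rintro ⟨r, ⟨k, ⟨h1, h2⟩, h3, h4⟩ | ⟨k, ⟨h1, h2⟩, h3, h4⟩⟩
    · exact Or.inl ⟨k, h1.symm, h2.symm, h3.symm⟩
    · exact Or.inr ⟨k, h2.symm, h1.symm, h4.symm⟩
  · rintro (⟨k, rfl, rfl, rfl⟩ | ⟨k, rfl, rfl, rfl⟩)
    · exact ⟨q k, Or.inl ⟨k, ⟨rfl, rfl⟩, rfl, rfl⟩⟩
    · exact ⟨p k, Or.inr ⟨k, ⟨rfl, rfl⟩, rfl, rfl⟩⟩

theorem famE_five (f : Fin 5 → Sym2 V) :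
    famE f = f 0 ::ₘ f 1 ::ₘ f 2 ::ₘ f 3 ::ₘ f 4 ::ₘ 0 := rfl
theorem fam_five (f : Fin 5 → CE V) :
    fam f = f 0 ::ₘ f 1 ::ₘ f 2 ::ₘ f 3 ::ₘ f 4 ::ₘ 0 := rfl

theorem fam_forget {f g : Fin 5 → V} {p q : Fin 5 → Fin 5} :
    (fam fun j => ((f j, g j), (p j, q j))).map forget = famE fun j => s(f j, g j) := by
  unfold fam famE
  rw [Multiset.map_map]; rfl

theorem GoodC_fam {f g : Fin 5 → V} {p q : Fin 5 → Fin 5} (h : ∀ k, grp (p k) ≠ grp (q k)) :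
    GoodC (fam fun j => ((f j, g j), (p j, q j))) := by
  intro e he
  obtain ⟨k, _, rfl⟩ := Multiset.mem_map.1 he
  exact h k

theorem uncons5 {K : Multiset (CE V)} {f g : Fin 5 → V} {M : Multiset (Sym2 V)}
    (h : K.map forget = famE (fun j => s(f j, g j)) + M) (hg : GoodC K) :
    ∃ (p q : Fin 5 → Fin 5) (K0 : Multiset (CE V)), K0.map forget = M ∧ GoodC K0 ∧ (∀ k : Fin 5, grp (p k) ≠ grp (q k)) ∧
      ∀ c u v, arc K c u v ↔ arc (fam (fun j => ((f j, g j), (p j, q j))) + K0) c u v := by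
  rw [famE_five] at h
  simp only [Multiset.cons_add, zero_add] at h
  obtain ⟨p0, q0, K1, h1, g1, hp0, ha0⟩ := uncons h hg
  obtain ⟨p1, q1, K2, h2, g2, hp1, ha1⟩ := uncons h1 g1
  obtain ⟨p2, q2, K3, h3, g3, hp2, ha2⟩ := uncons h2 g2
  obtain ⟨p3, q3, K4, h4, g4, hp3, ha3⟩ := uncons h3 g3
  obtain ⟨p4, q4, K5, h5, g5, hp4, ha4⟩ := uncons h4 g4
  refine ⟨![p0, p1, p2, p3, p4], ![q0, q1, q2, q3, q4], K5, h5, g5, ?_, ?_⟩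
  · intro k; fin_cases k
    exacts [hp0, hp1, hp2, hp3, hp4]
  · intro c u v
    rw [fam_five]
    simp only [Multiset.cons_add, zero_add]
    rw [ha0, arc_cons, ha1, arc_cons, ha2, arc_cons, ha3, arc_cons, ha4]
    rw [arc_cons, arc_cons, arc_cons, arc_cons, arc_cons, arc_cons]
    rfl

theorem ring_match : ∀ p q r s : Fin 5, p ≠ q → r ≠ s → p ≠ r → p ≠ s → q ≠ r → q ≠ s →
    (grp p ≠ grp r ∧ grp q ≠ grp s) ∨ (grp p ≠ grp s ∧ grp q ≠ grp r) := by
  intro p q r s; revert p q r s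
  set_option synthInstance.maxHeartbeats 400000 in
  set_option synthInstance.maxSize 1000 in
  decide +kernel

theorem ring_color {S S' : Finset V} {t : V} {v o : Fin 5 → V} {M0 : Multiset (Sym2 V)}
    (hvt : ∀ j, v j ≠ t) (ho : ∀ j, o j ∈ S') (hov : ∀ j k, o j ≠ v k)
    (hv0 : v 0 ∈ S') (hS : ∀ x ∈ S, x ∈ S' ∨ ∃ j, x = v j)
    (hM0 : ∀ e ∈ M0, v 0 ∉ e)
    (h : Sol S' (famE (fun j => s(v 0, o j)) + M0) t) :
    Sol S (famE (fun j => s(v j, o j)) + (famE (fun j => s(v j, v (j + 1))) +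
      (famE (fun j => s(v j, v (j + 1))) + M0))) t := by
  obtain ⟨K, hK, hg, hr⟩ := h
  obtain ⟨c, i, K0, hK0, hg0, hci, harc⟩ := uncons5 (f := fun _ => v 0) hK hg
  have hz0 : ∀ x w, ¬ arc K0 x (v 0) w := by
    intro c v h
    have := arc_mem h
    rw [hK0] at this
    exact hM0 _ this (Sym2.mem_mk_left _ _)
  have harcz : ∀ x w, arc K x (v 0) w → ∃ j, w = o j ∧ x = c j := by
    intro x w h
    rw [harc, arc_add, arc_fam] at h
    rcases h with (⟨j, _, h, h'⟩ | ⟨j, h, _⟩) | h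
    · exact ⟨j, h, h'⟩
    · exact absurd h.symm (hov _ _)
    · exact absurd h (hz0 _ _)
  have hsurj : Function.Surjective c := by
    intro x
    rcases ReflTransGen.cases_head (hr x _ hv0) with h | ⟨w, h, _⟩
    · exact absurd h (hvt 0)
    · obtain ⟨j, _, h⟩ := harcz _ _ h
      exact ⟨j, h.symm⟩
  have hinj : Function.Injective c := Finite.injective_iff_surjective.2 hsurj
  have hch : ∀ j : Fin 5, ∃ b1 b2, grp (c (j + 1)) ≠ grp b1 ∧ grp (c (j + 2)) ≠ grp b2 ∧
      ((b1 = c j ∧ b2 = c (j + 4)) ∨ (b1 = c (j + 4) ∧ b2 = c j)) := by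
    intro j
    have hne : ∀ x y : Fin 5, x ≠ y → c (j + x) ≠ c (j + y) := by
      intro x y hxy h
      exact hxy (add_left_cancel (hinj h))
    have hne0 : ∀ x : Fin 5, x ≠ 0 → c (j + x) ≠ c j := by
      intro x hx
      have := hne x 0 hx
      rwa [add_zero] at this
    rcases ring_match (c (j+1)) (c (j+2)) (c j) (c (j+4)) (hne _ _ (by decide))
      (hne0 _ (by decide)).symm (hne0 _ (by decide)) (hne _ _ (by decide)) (hne0 _ (by decide))
      (hne _ _ (by decide)) with h | h
    · exact ⟨_, _, h.1, h.2, Or.inl ⟨rfl, rfl⟩⟩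
    · exact ⟨_, _, h.1, h.2, Or.inr ⟨rfl, rfl⟩⟩
  choose b1 b2 hb1 hb2 hb using hch
  set K' := fam (fun j => ((v j, o j), (c j, i j))) +
    (fam (fun j => ((v j, v (j + 1)), (c (j + 1), b1 j))) +
      (fam (fun j => ((v j, v (j + 1)), (c (j + 2), b2 j))) + K0)) with hK'
  have hout : ∀ j, arc K' (c j) (v j) (o j) := by
    intro j
    rw [hK', arc_add, arc_fam]
    exact Or.inl (Or.inl ⟨j, rfl, rfl, rfl⟩)
  have hin : ∀ j, arc K' (i j) (o j) (v j) := by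
    intro j
    rw [hK', arc_add, arc_fam]
    exact Or.inl (Or.inr ⟨j, rfl, rfl, rfl⟩)
  have hcw1 : ∀ j, arc K' (c (j + 1)) (v j) (v (j + 1)) := by
    intro j
    rw [hK', arc_add, arc_add, arc_fam, arc_fam]
    exact Or.inr (Or.inl (Or.inl ⟨j, rfl, rfl, rfl⟩))
  have hcw2 : ∀ j, arc K' (c (j + 2)) (v j) (v (j + 1)) := by
    intro j
    rw [hK', arc_add, arc_add, arc_add, arc_fam, arc_fam, arc_fam]
    exact Or.inr (Or.inr (Or.inl (Or.inl ⟨j, rfl, rfl, rfl⟩)))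
  have hb1a : ∀ j, arc K' (b1 j) (v (j + 1)) (v j) := by
    intro j
    rw [hK', arc_add, arc_add, arc_fam, arc_fam]
    exact Or.inr (Or.inl (Or.inr ⟨j, rfl, rfl, rfl⟩))
  have hb2a : ∀ j, arc K' (b2 j) (v (j + 1)) (v j) := by
    intro j
    rw [hK', arc_add, arc_add, arc_add, arc_fam, arc_fam, arc_fam]
    exact Or.inr (Or.inr (Or.inl (Or.inr ⟨j, rfl, rfl, rfl⟩)))
  have hccw1 : ∀ j, arc K' (c j) (v (j + 1)) (v j) := by
    intro j
    rcases hb j with h | h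
    · rw [← h.1]; exact hb1a j
    · rw [← h.2]; exact hb2a j
  have hccw2 : ∀ j, arc K' (c (j + 4)) (v (j + 1)) (v j) := by
    intro j
    rcases hb j with h | h
    · rw [← h.2]; exact hb2a j
    · rw [← h.1]; exact hb1a j
  have hk0 : ∀ x u w, arc K0 x u w → arc K' x u w := by
    intro x u w h
    rw [hK', arc_add, arc_add, arc_add]
    exact Or.inr (Or.inr (Or.inr h))
  have hexit : ∀ e, Rch K' (c e) (v e) t := by
    intro e
    obtain ⟨w, b, rfl, h1, h2⟩ := last_exit (Z := fun u => u = v 0) (hr (c e) _ hv0) rfl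
      (hvt 0).symm
    obtain ⟨j, rfl, hj⟩ := harcz _ _ h1
    rw [hinj hj] at *
    refine .head (hout j) ?_
    generalize o j = y at h2
    induction h2 using ReflTransGen.head_induction_on with
    | refl => exact .refl
    | head h3 h4 ih =>
      rename_i y w
      have h5 := h3.1
      rw [harc, arc_add, arc_fam] at h5
      rcases h5 with (⟨k, h, _⟩ | ⟨k, _, h, h'⟩) | h
      · exact absurd h h3.2
      · subst h
        rcases ReflTransGen.cases_head h4 with h | ⟨_, h, _⟩
        · exact absurd h (hvt 0)
        · exact absurd rfl h.2
      · exact .head (hk0 _ _ _ h) ih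
  have hring : ∀ x j, Rch K' x (v j) t := by
    intro x j
    obtain ⟨e, rfl⟩ := hsurj x
    have hm1 : Rch K' (c e) (v (e + 4)) t := by
      have := hcw1 (e + 4)
      rw [add_assoc, show (4 + 1 : Fin 5) = 0 from rfl, add_zero] at this
      exact .head this (hexit e)
    have hm2 : Rch K' (c e) (v (e + 3)) t := by
      have := hcw2 (e + 3)
      rw [add_assoc, add_assoc, show (3 + 1 : Fin 5) = 4 from rfl,
        show (3 + 2 : Fin 5) = 0 from rfl, add_zero] at this
      exact .head this hm1
    have hp1 : Rch K' (c e) (v (e + 1)) t := .head (hccw1 e) (hexit e)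
    have hp2 : Rch K' (c e) (v (e + 2)) t := by
      have := hccw2 (e + 1)
      rw [add_assoc, add_assoc, show (1 + 1 : Fin 5) = 2 from rfl,
        show (1 + 4 : Fin 5) = 0 from rfl, add_zero] at this
      exact .head this hp1
    have hall : ∀ d : Fin 5, Rch K' (c e) (v (e + d)) t := by
      intro d
      fin_cases d
      · show Rch K' (c e) (v (e + 0)) t
        rw [add_zero]; exact hexit e
      · exact hp1
      · exact hp2
      · exact hm2
      · exact hm1
    have := hall (j - e)
    rwa [add_sub_cancel] at this
  refine ⟨K', ?_, ?_, ?_⟩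
  · simp only [hK', Multiset.map_add, fam_forget, hK0]
  · exact GoodC_add (GoodC_fam hci) (GoodC_add (GoodC_fam hb1) (GoodC_add (GoodC_fam hb2) hg0))
  · intro x y hy
    rcases hS y hy with hy' | ⟨j, rfl⟩
    · have := hr x y hy'
      clear hy hy'
      unfold Rch at this
      induction this using ReflTransGen.head_induction_on with
      | refl => exact .refl
      | head h3 h4 ih =>
        rename_i y w
        rw [harc, arc_add, arc_fam] at h3
        rcases h3 with (⟨k, h, _⟩ | ⟨k, h, h', h''⟩) | h
        · rw [h]; exact hring _ _
        · subst h
          rw [h'']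
          exact .head (hin k) (hring _ _)
        · exact .head (hk0 _ _ _ h) ih
    · exact hring _ _
end FRR

namespace FRR
open Relation
open scoped Classical

variable {V : Type*}

/-- Indicator that an edge crosses the set `X`. -/
noncomputable def cutc (X : Set V) : Sym2 V → ℕ :=
  Sym2.lift ⟨fun u v => if (u ∈ X ↔ v ∈ X) then 0 else 1, fun u v => by simp only [iff_comm]⟩

theorem cutc_mk (X : Set V) (u v : V) :
    cutc X s(u, v) = if (u ∈ X ↔ v ∈ X) then 0 else 1 := rfl

/-- Number of edges crossing `X`. -/
noncomputable def cut (M : Multiset (Sym2 V)) (X : Set V) : ℕ := (M.map (cutc X)).sum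

theorem cut_zero (X : Set V) : cut (0 : Multiset (Sym2 V)) X = 0 := rfl
theorem cut_cons (e : Sym2 V) (M : Multiset (Sym2 V)) (X : Set V) :
    cut (e ::ₘ M) X = cutc X e + cut M X := by simp [cut]
theorem cut_add (M N : Multiset (Sym2 V)) (X : Set V) :
    cut (M + N) X = cut M X + cut N X := by simp [cut]

theorem cutc_compl (X : Set V) (e : Sym2 V) : cutc Xᶜ e = cutc X e := by
  induction e with | _ u v
  simp only [cutc_mk, Set.mem_compl_iff, not_iff_not]

theorem cut_compl (M : Multiset (Sym2 V)) (X : Set V) : cut M Xᶜ = cut M X := by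
  unfold cut
  congr 1
  exact Multiset.map_congr rfl fun e _ => cutc_compl X e

theorem cut_congr {M : Multiset (Sym2 V)} {X Y : Set V}
    (h : ∀ e ∈ M, ∀ v ∈ e, (v ∈ X ↔ v ∈ Y)) : cut M X = cut M Y := by
  unfold cut
  congr 1
  refine Multiset.map_congr rfl fun e he => ?_
  induction e with | _ u v
  rw [cutc_mk, cutc_mk, h _ he u (Sym2.mem_mk_left _ _), h _ he v (Sym2.mem_mk_right _ _)]

/-- Indicator of an edge between `A` and `B`. -/
noncomputable def btc (A B : Set V) : Sym2 V → ℕ :=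
  Sym2.lift ⟨fun u v => if (u ∈ A ∧ v ∈ B) ∨ (v ∈ A ∧ u ∈ B) then 1 else 0,
    fun u v => by simp only [or_comm]⟩

theorem btc_mk (A B : Set V) (u v : V) :
    btc A B s(u, v) = if (u ∈ A ∧ v ∈ B) ∨ (v ∈ A ∧ u ∈ B) then 1 else 0 := rfl

noncomputable def btw (M : Multiset (Sym2 V)) (A B : Set V) : ℕ := (M.map (btc A B)).sum

theorem btw_cons (e : Sym2 V) (M : Multiset (Sym2 V)) (A B : Set V) :
    btw (e ::ₘ M) A B = btc A B e + btw M A B := by simp [btw]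
theorem btw_add (M N : Multiset (Sym2 V)) (A B : Set V) :
    btw (M + N) A B = btw M A B + btw N A B := by simp [btw]

theorem btw_comm (M : Multiset (Sym2 V)) (A B : Set V) : btw M A B = btw M B A := by
  unfold btw
  congr 1
  refine Multiset.map_congr rfl fun e _ => ?_
  induction e with | _ u v
  simp only [btc_mk, and_comm, or_comm]

theorem btw_pos {M : Multiset (Sym2 V)} {A B : Set V} (h : btw M A B ≠ 0) :
    ∃ u ∈ A, ∃ v ∈ B, s(u, v) ∈ M := by
  by_contra hcon
  push Not at hcon
  apply h
  unfold btw
  rw [Multiset.sum_eq_zero_iff]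
  intro x hx
  obtain ⟨e, he, rfl⟩ := Multiset.mem_map.1 hx
  induction e with | _ u v
  rw [btc_mk, if_neg]
  rintro (⟨h1, h2⟩ | ⟨h1, h2⟩)
  · exact hcon _ h1 _ h2 he
  · exact hcon _ h1 _ h2 (by rw [Sym2.eq_swap]; exact he)

theorem cut_union {M : Multiset (Sym2 V)} {A B : Set V} (h : Disjoint A B) :
    cut M (A ∪ B) + 2 * btw M A B = cut M A + cut M B := by
  induction M using Multiset.induction with
  | empty => simp [cut, btw]
  | cons e M ih =>
    rw [cut_cons, cut_cons, cut_cons, btw_cons]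
    have : cutc (A ∪ B) e + 2 * btc A B e = cutc A e + cutc B e := by
      induction e with | _ u v
      have hu : u ∈ A → u ∉ B := fun h1 h2 => Set.disjoint_left.1 h h1 h2
      have hv : v ∈ A → v ∉ B := fun h1 h2 => Set.disjoint_left.1 h h1 h2
      simp only [cutc_mk, btc_mk, Set.mem_union]
      by_cases h1 : u ∈ A <;> by_cases h2 : u ∈ B <;> by_cases h3 : v ∈ A <;>
        by_cases h4 : v ∈ B <;> simp_all
    omega

theorem btw_union {M : Multiset (Sym2 V)} {A B C : Set V} (hAB : Disjoint A B)
    (hAC : Disjoint A C) (hBC : Disjoint B C) :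
    btw M A (B ∪ C) = btw M A B + btw M A C := by
  induction M using Multiset.induction with
  | empty => simp [btw]
  | cons e M ih =>
    rw [btw_cons, btw_cons, btw_cons]
    have : btc A (B ∪ C) e = btc A B e + btc A C e := by
      induction e with | _ u v
      have hu : u ∈ A → u ∉ B := fun h1 h2 => Set.disjoint_left.1 hAB h1 h2
      have hv : v ∈ A → v ∉ B := fun h1 h2 => Set.disjoint_left.1 hAB h1 h2
      have hu1 : u ∈ A → u ∉ C := fun h1 h2 => Set.disjoint_left.1 hAC h1 h2
      have hv1 : v ∈ A → v ∉ C := fun h1 h2 => Set.disjoint_left.1 hAC h1 h2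
      have hu2 : u ∈ B → u ∉ C := fun h1 h2 => Set.disjoint_left.1 hBC h1 h2
      have hv2 : v ∈ B → v ∉ C := fun h1 h2 => Set.disjoint_left.1 hBC h1 h2
      simp only [btc_mk, Set.mem_union]
      by_cases h1 : u ∈ A <;> by_cases h2 : u ∈ B <;> by_cases h3 : v ∈ A <;>
        by_cases h4 : v ∈ B <;> simp_all
    omega

/-- Submodularity. -/
theorem cut_submod (M : Multiset (Sym2 V)) (A B : Set V) :
    cut M (A ∩ B) + cut M (A ∪ B) ≤ cut M A + cut M B := by
  induction M using Multiset.induction with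
  | empty => simp [cut]
  | cons e M ih =>
    simp only [cut_cons]
    have : cutc (A ∩ B) e + cutc (A ∪ B) e ≤ cutc A e + cutc B e := by
      induction e with | _ u v
      simp only [cutc_mk, Set.mem_union, Set.mem_inter_iff]
      by_cases h1 : u ∈ A <;> by_cases h2 : u ∈ B <;> by_cases h3 : v ∈ A <;>
        by_cases h4 : v ∈ B <;> simp_all
    omega

theorem cut_posimod (M : Multiset (Sym2 V)) (A B : Set V) :
    cut M (A \ B) + cut M (B \ A) ≤ cut M A + cut M B := by
  have := cut_submod M A Bᶜ
  rw [cut_compl, ← Set.diff_eq] at this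
  rw [← cut_compl M (B \ A)]
  have h2 : (B \ A)ᶜ = A ∪ Bᶜ := by ext x; simp; tauto
  rw [h2]; exact this

theorem cut_three (M : Multiset (Sym2 V)) (X Y W : Set V) :
    cut M (X ∩ Y ∩ W) + cut M (X \ (Y ∪ W)) + cut M (Y \ (X ∪ W)) + cut M (W \ (X ∪ Y)) ≤
      cut M X + cut M Y + cut M W := by
  induction M using Multiset.induction with
  | empty => simp [cut]
  | cons e M ih =>
    simp only [cut_cons]
    have : cutc (X ∩ Y ∩ W) e + cutc (X \ (Y ∪ W)) e + cutc (Y \ (X ∪ W)) e +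
        cutc (W \ (X ∪ Y)) e ≤ cutc X e + cutc Y e + cutc W e := by
      induction e with | _ u v
      simp only [cutc_mk, Set.mem_union, Set.mem_inter_iff, Set.mem_diff]
      by_cases h1 : u ∈ X <;> by_cases h2 : u ∈ Y <;> by_cases h3 : u ∈ W <;>
        by_cases h4 : v ∈ X <;> by_cases h5 : v ∈ Y <;> by_cases h6 : v ∈ W <;> simp [*]
    omega

/-- `X` separates the terminal set `T`. -/
def sep (T : Finset V) (X : Set V) : Prop := (∃ a ∈ T, a ∈ X) ∧ (∃ b ∈ T, b ∉ X)

theorem sep_compl {T : Finset V} {X : Set V} (h : sep T X) : sep T Xᶜ := by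
  obtain ⟨⟨a, ha, ha'⟩, b, hb, hb'⟩ := h
  exact ⟨⟨b, hb, hb'⟩, a, ha, fun h => h ha'⟩

def conn (T : Finset V) (M : Multiset (Sym2 V)) : Prop := ∀ X, sep T X → 5 ≤ cut M X

theorem star4_four (z : V) (a : Fin 4 → V) :
    star4 z a = s(z, a 0) ::ₘ s(z, a 1) ::ₘ s(z, a 2) ::ₘ s(z, a 3) ::ₘ 0 := rfl

theorem bad_set {T : Finset V} {M0 : Multiset (Sym2 V)} {p q r s : V}
    (h1 : ∀ X, sep T X → 5 ≤ cut M0 X + ((if p ∈ X then 1 else 0) + (if q ∈ X then 1 else 0) +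
      (if r ∈ X then 1 else 0) + (if s ∈ X then 1 else 0)))
    (h2 : ¬ conn T (s(p, q) ::ₘ s(r, s) ::ₘ M0)) :
    ∃ X, p ∈ X ∧ q ∈ X ∧ r ∉ X ∧ s ∉ X ∧ cut M0 X ≤ 4 := by
  unfold conn at h2
  push Not at h2
  obtain ⟨X, hX, hlt⟩ := h2
  rw [cut_cons, cut_cons, cutc_mk, cutc_mk] at hlt
  have a1 := h1 X hX
  have a2 := h1 Xᶜ (sep_compl hX)
  rw [cut_compl] at a2
  simp only [Set.mem_compl_iff] at a2
  by_cases hp : p ∈ X <;> by_cases hq : q ∈ X <;> by_cases hr : r ∈ X <;> by_cases hs : s ∈ X <;>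
    simp only [hp, hq, hr, hs, if_true, if_false, not_true, not_false_iff, iff_self,
      iff_true, iff_false, true_iff, false_iff] at hlt a1 a2 <;> try omega
  · exact ⟨X, hp, hq, hr, hs, by omega⟩
  · exact ⟨Xᶜ, hp, hq, fun h => h hr, fun h => h hs, by rw [cut_compl]; omega⟩

theorem split_lemma {T : Finset V} {z : V} {a : Fin 4 → V} {M0 : Multiset (Sym2 V)}
    (hz : z ∉ T) (ha : ∀ k, a k ∈ T) (hM0 : ∀ e ∈ M0, z ∉ e) (hc : conn T (star4 z a + M0)) :
    ∃ a' : Fin 4 → V, star4 z a' = star4 z a ∧ (∀ k, a' k ∈ T) ∧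
      conn T (s(a' 0, a' 1) ::ₘ s(a' 2, a' 3) ::ₘ M0) := by
  have haz : ∀ k, a k ≠ z := fun k h => hz (h ▸ ha k)
  have h1 : ∀ X, sep T X → 5 ≤ cut M0 X + ((if a 0 ∈ X then 1 else 0) +
      (if a 1 ∈ X then 1 else 0) +
      (if a 2 ∈ X then 1 else 0) + (if a 3 ∈ X then 1 else 0)) := by
    intro X hX
    have hs : sep T (X \ {z}) := by
      obtain ⟨⟨x, hx, hx'⟩, y, hy, hy'⟩ := hX
      exact ⟨⟨x, hx, hx', fun h => hz (by rw [← Set.mem_singleton_iff.1 h]; exact hx)⟩, y, hy, fun h => hy' h.1⟩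
    have := hc _ hs
    rw [cut_add, star4_four] at this
    have he : cut M0 (X \ {z}) = cut M0 X := by
      apply cut_congr
      intro e he v hv
      have : v ≠ z := by rintro rfl; exact hM0 e he hv
      simp [this]
    rw [he] at this
    simp only [cut_cons, cutc_mk, cut_zero, Set.mem_diff, Set.mem_singleton_iff, haz,
      not_true, and_false, false_iff, not_false_iff, and_true, ite_not] at this
    omega
  by_contra hcon
  push Not at hcon
  have n1 := hcon a rfl ha
  have n2 := hcon ![a 0, a 2, a 1, a 3] (by
      rw [star4_four, star4_four]
      simp only [Matrix.cons_val]
      rw [Multiset.cons_swap s(z, a 2)]) (by intro k; fin_cases k <;> simp [ha])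
  have n3 := hcon ![a 0, a 3, a 1, a 2] (by
      rw [star4_four, star4_four]
      simp only [Matrix.cons_val]
      rw [Multiset.cons_swap s(z, a 3) s(z, a 1), Multiset.cons_swap s(z, a 3) s(z, a 2)])
      (by intro k; fin_cases k <;> simp [ha])
  simp only [Matrix.cons_val] at n2 n3
  obtain ⟨X, x0, x1, x2, x3, hX⟩ := bad_set h1 n1
  obtain ⟨Y, y0, y2, y1, y3, hY⟩ := bad_set (fun X hX => by have := h1 X hX; omega) n2
  obtain ⟨W, w0, w3, w1, w2, hW⟩ := bad_set (fun X hX => by have := h1 X hX; omega) n3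
  have key := cut_three M0 X Y W
  have c1 := h1 (X ∩ Y ∩ W) ⟨⟨a 0, ha 0, ⟨x0, y0⟩, w0⟩, a 1, ha 1, fun h => y1 h.1.2⟩
  have c2 := h1 (X \ (Y ∪ W)) ⟨⟨a 1, ha 1, x1, fun h => h.elim y1 w1⟩, a 2, ha 2,
    fun h => x2 h.1⟩
  have c3 := h1 (Y \ (X ∪ W)) ⟨⟨a 2, ha 2, y2, fun h => h.elim x2 w2⟩, a 1, ha 1,
    fun h => y1 h.1⟩
  have c4 := h1 (W \ (X ∪ Y)) ⟨⟨a 3, ha 3, w3, fun h => h.elim x3 y3⟩, a 1, ha 1,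
    fun h => w1 h.1⟩
  simp only [Set.mem_inter_iff, Set.mem_diff, Set.mem_union, x0, x1, x2, x3, y0, y1, y2, y3,
    w0, w1, w2, w3, and_true, true_and, and_false, false_and, or_true, true_or, or_false,
    false_or, not_true, not_false_iff, if_true, if_false, or_self, and_self] at c1 c2 c3 c4
  omega

/-- Star decomposition. -/
theorem star_decomp (M : Multiset (Sym2 V)) (z : V) (hl : ∀ e ∈ M, ¬ e.IsDiag) :
    ∃ (N : Multiset V) (M0 : Multiset (Sym2 V)), M = N.map (fun x => s(z, x)) + M0 ∧
      N.card = cut M {z} ∧ (∀ e ∈ M0, z ∉ e) ∧ ∀ x ∈ N, x ≠ z := by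
  induction M using Multiset.induction with
  | empty => exact ⟨0, 0, by simp, by simp [cut], by simp, by simp⟩
  | cons e M ih =>
    obtain ⟨N, M0, h1, h2, h3, h4⟩ := ih fun e he => hl e (Multiset.mem_cons_of_mem he)
    have he := hl e (Multiset.mem_cons_self _ _)
    by_cases hz : z ∈ e
    · obtain ⟨x, rfl⟩ := hz
      have hxz : x ≠ z := fun h => he (by rw [h]; rfl)
      refine ⟨x ::ₘ N, M0, ?_, ?_, h3, ?_⟩
      · rw [Multiset.map_cons, Multiset.cons_add, ← h1]
      · rw [Multiset.card_cons, h2, cut_cons, cutc_mk, if_neg, add_comm]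
        simp [hxz]
      · intro y hy
        rcases Multiset.mem_cons.1 hy with rfl | hy
        · exact hxz
        · exact h4 y hy
    · refine ⟨N, e ::ₘ M0, ?_, ?_, ?_, h4⟩
      · rw [Multiset.add_cons, ← h1]
      · rw [h2, cut_cons]
        induction e with | _ u v
        rw [cutc_mk, if_pos, zero_add]
        rw [Sym2.mem_iff, not_or] at hz
        simp [Ne.symm hz.1, Ne.symm hz.2]
      · intro e' he'
        rcases Multiset.mem_cons.1 he' with rfl | he'
        · exact hz
        · exact h3 _ he'

theorem star_decomp4 {M : Multiset (Sym2 V)} {z : V} (hl : ∀ e ∈ M, ¬ e.IsDiag)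
    (hc : cut M {z} = 4) :
    ∃ (a : Fin 4 → V) (M0 : Multiset (Sym2 V)), M = star4 z a + M0 ∧
      (∀ e ∈ M0, z ∉ e) ∧ ∀ k, a k ≠ z := by
  obtain ⟨N, M0, h1, h2, h3, h4⟩ := star_decomp M z hl
  rw [hc] at h2
  obtain ⟨l, rfl⟩ := Quot.exists_rep N
  have hlen : l.length = 4 := h2
  obtain ⟨x0, x1, x2, x3, rfl⟩ : ∃ x0 x1 x2 x3, l = [x0, x1, x2, x3] := by
    match l, hlen with
    | [x0, x1, x2, x3], _ => exact ⟨x0, x1, x2, x3, rfl⟩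
  refine ⟨![x0, x1, x2, x3], M0, h1, h3, ?_⟩
  intro k
  apply h4
  fin_cases k <;> simp
end FRR

namespace FRR
open Relation
open scoped Classical

variable {V : Type*}

def inS (S : Finset V) (M : Multiset (Sym2 V)) : Prop := ∀ e ∈ M, ∀ v ∈ e, v ∈ S

/-- The induction hypothesis of the colouring theorem. -/
def IndHyp (t : V) (n : ℕ) : Prop := ∀ (S : Finset V) (M : Multiset (Sym2 V)), M.card < n → t ∈ S →
  inS S M → conn S M → Sol S M t

theorem star4_mem {z : V} {a : Fin 4 → V} (k : Fin 4) : s(z, a k) ∈ star4 z a :=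
  Multiset.mem_map.2 ⟨k, Finset.mem_univ k, rfl⟩

theorem star4_card {z : V} {a : Fin 4 → V} : (star4 z a).card = 4 := by
  simp [star4]

theorem mem_star4_congr {z : V} {a a' : Fin 4 → V} (h : star4 z a' = star4 z a) (k : Fin 4) :
    ∃ l, a' k = a l := by
  have := star4_mem (z := z) (a := a') k
  rw [h] at this
  obtain ⟨l, _, hl⟩ := Multiset.mem_map.1 this
  exact ⟨l, (Sym2.congr_right.1 hl).symm⟩

theorem op2 [DecidableEq V] {S : Finset V} {M : Multiset (Sym2 V)} {t z w : V}
    (IH : IndHyp t M.card) (hin : inS S M) (hl : ∀ e ∈ M, ¬ e.IsDiag) (hc : conn S M)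
    (ht : t ∈ S) (hzt : z ≠ t) (he : s(z, w) ∈ M) (hz : cut M {z} = 5)
    (honly : ∀ X : Set V, z ∈ X → w ∉ X → cut M X = 5 → ∀ x ∈ S, x ∈ X → x = z) :
    Sol S M t := by
  obtain ⟨M1, rfl⟩ := Multiset.exists_cons_of_mem he
  have hzw : w ≠ z := fun h => hl _ he (by rw [h]; rfl)
  have hzS : z ∈ S := hin _ he z (Sym2.mem_mk_left _ _)
  have hwS : w ∈ S := hin _ he w (Sym2.mem_mk_right _ _)
  have h4 : cut M1 {z} = 4 := by
    rw [cut_cons, cutc_mk, if_neg (by simp [hzw])] at hz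
    omega
  obtain ⟨a, M0, rfl, hM0, ha⟩ := star_decomp4
    (fun e he => hl e (Multiset.mem_cons_of_mem he)) h4
  have haS : ∀ k, a k ∈ S.erase z := fun k => Finset.mem_erase.2 ⟨ha k,
    hin _ (Multiset.mem_cons_of_mem (Multiset.mem_add.2 (Or.inl (star4_mem k)))) _
      (Sym2.mem_mk_right _ _)⟩
  have hconn : conn (S.erase z) (star4 z a + M0) := by
    intro X hX
    have hsep : sep S X := by
      obtain ⟨⟨x, hx, hx'⟩, y, hy, hy'⟩ := hX
      exact ⟨⟨x, Finset.mem_of_mem_erase hx, hx'⟩, y, Finset.mem_of_mem_erase hy, hy'⟩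
    have h5 := hc X hsep
    by_contra hlt
    have h6 := h5
    rw [cut_cons, cutc_mk] at h6
    split_ifs at h6 with hif
    · omega
    · have heq : cut (s(z, w) ::ₘ (star4 z a + M0)) X = 5 := by
        rw [cut_cons, cutc_mk, if_neg hif]; omega
      obtain ⟨⟨x, hx, hx'⟩, y, hy, hy'⟩ := hX
      by_cases hzX : z ∈ X
      · have hwX : w ∉ X := fun h => hif (by simp [hzX, h])
        exact Finset.ne_of_mem_erase hx (honly X hzX hwX heq x (Finset.mem_of_mem_erase hx) hx')
      · have hwX : w ∈ X := by by_contra h; exact hif (by simp [hzX, h])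
        exact Finset.ne_of_mem_erase hy (honly Xᶜ hzX (fun h => h hwX)
          (by rw [cut_compl]; exact heq) y (Finset.mem_of_mem_erase hy) hy')
  obtain ⟨a', hs, ha', hc'⟩ := split_lemma (Finset.notMem_erase z S) haS hM0 hconn
  rw [← hs]
  refine op2_color hzt ha' (Finset.mem_erase.2 ⟨hzw, hwS⟩) hM0 ?_
  apply IH
  · simp only [Multiset.card_cons, Multiset.card_add, star4_card]; omega
  · exact Finset.mem_erase.2 ⟨hzt.symm, ht⟩
  · intro e he v hv
    rcases Multiset.mem_cons.1 he with rfl | he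
    · rcases Sym2.mem_iff.1 hv with rfl | rfl <;> exact ha' _
    rcases Multiset.mem_cons.1 he with rfl | he
    · rcases Sym2.mem_iff.1 hv with rfl | rfl <;> exact ha' _
    · refine Finset.mem_erase.2 ⟨?_, hin e (by simp [he]) v hv⟩
      intro hh
      exact hM0 e he (hh ▸ hv)
  · exact hc'

theorem op3 [DecidableEq V] {S : Finset V} {M : Multiset (Sym2 V)} {t z w : V}
    (IH : IndHyp t M.card) (hin : inS S M) (hl : ∀ e ∈ M, ¬ e.IsDiag) (hc : conn S M)
    (ht : t ∈ S) (hzt : z ≠ t) (hwt : w ≠ t) (he : s(z, w) ∈ M) (he' : M.count s(z, w) = 1)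
    (hz : cut M {z} = 5) (hw : cut M {w} = 5)
    (honly : ∀ X : Set V, z ∈ X → w ∉ X → cut M X = 5 →
      (∀ x ∈ S, x ∈ X → x = z) ∨ (∀ x ∈ S, x ∉ X → x = w)) :
    Sol S M t := by
  obtain ⟨M1, rfl⟩ := Multiset.exists_cons_of_mem he
  have hzw : w ≠ z := fun h => hl _ he (by rw [h]; rfl)
  have hnot : s(z, w) ∉ M1 := by
    rw [Multiset.count_cons_self] at he'
    rw [← Multiset.count_eq_zero]; omega
  have h4 : cut M1 {z} = 4 := by
    rw [cut_cons, cutc_mk, if_neg (by simp [hzw])] at hz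
    omega
  have h4w : cut M1 {w} = 4 := by
    rw [cut_cons, cutc_mk, if_neg (by simp [hzw.symm])] at hw
    omega
  obtain ⟨a, M', rfl, hM', ha⟩ := star_decomp4
    (fun e he => hl e (Multiset.mem_cons_of_mem he)) h4
  have haw : ∀ k, a k ≠ w := by
    intro k h
    apply hnot
    rw [← h]
    exact Multiset.mem_add.2 (Or.inl (star4_mem k))
  have h4w' : cut M' {w} = 4 := by
    rw [cut_add] at h4w
    have : cut (star4 z a) {w} = 0 := by
      rw [star4_four]
      simp only [cut_cons, cutc_mk, cut_zero, Set.mem_singleton_iff, haw, hzw.symm, if_true]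
    omega
  obtain ⟨b, M0, rfl, hM0, hb⟩ := star_decomp4
    (fun e he => hl e (by simp [he])) h4w'
  have hbz : ∀ k, b k ≠ z := by
    intro k h
    exact hM' _ (Multiset.mem_add.2 (Or.inl (star4_mem k))) (by rw [h]; exact Sym2.mem_mk_right _ _)
  have hM0z : ∀ e ∈ M0, z ∉ e := fun e he => hM' e (by simp [he])
  set T := (S.erase z).erase w with hT
  have memT : ∀ x, x ∈ T ↔ x ≠ w ∧ x ≠ z ∧ x ∈ S := by
    intro x; rw [hT, Finset.mem_erase, Finset.mem_erase]
  have haT : ∀ k, a k ∈ T := fun k => (memT _).2 ⟨haw k, ha k,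
    hin _ (Multiset.mem_cons_of_mem (Multiset.mem_add.2 (Or.inl (star4_mem k)))) _
      (Sym2.mem_mk_right _ _)⟩
  have hbT : ∀ k, b k ∈ T := fun k => (memT _).2 ⟨hb k, hbz k,
    hin _ (Multiset.mem_cons_of_mem (Multiset.mem_add.2 (Or.inr
      (Multiset.mem_add.2 (Or.inl (star4_mem k)))))) _
      (Sym2.mem_mk_right _ _)⟩
  have hconn : conn T (star4 z a + (star4 w b + M0)) := by
    intro X hX
    have hsep : sep S X := by
      obtain ⟨⟨x, hx, hx'⟩, y, hy, hy'⟩ := hX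
      exact ⟨⟨x, ((memT _).1 hx).2.2, hx'⟩, y, ((memT _).1 hy).2.2, hy'⟩
    have h5 := hc X hsep
    by_contra hlt
    have h6 := h5
    rw [cut_cons, cutc_mk] at h6
    split_ifs at h6 with hif
    · omega
    · have heq : cut (s(z, w) ::ₘ (star4 z a + (star4 w b + M0))) X = 5 := by
        rw [cut_cons, cutc_mk, if_neg hif]; omega
      obtain ⟨⟨x, hx, hx'⟩, y, hy, hy'⟩ := hX
      rw [memT] at hx hy
      by_cases hzX : z ∈ X
      · have hwX : w ∉ X := fun h => hif (by simp [hzX, h])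
        rcases honly X hzX hwX heq with h | h
        · exact hx.2.1 (h x hx.2.2 hx')
        · exact hy.1 (h y hy.2.2 hy')
      · have hwX : w ∈ X := by by_contra h; exact hif (by simp [hzX, h])
        rcases honly Xᶜ hzX (fun h => h hwX) (by rw [cut_compl]; exact heq) with h | h
        · exact hy.2.1 (h y hy.2.2 hy')
        · exact hx.1 (h x hx.2.2 (fun h => h hx'))
  obtain ⟨a', hs, ha', hc'⟩ := split_lemma (fun h => ((memT _).1 h).2.1 rfl) haT hM' hconn
  have hre : s(a' 0, a' 1) ::ₘ s(a' 2, a' 3) ::ₘ (star4 w b + M0) =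
      star4 w b + (s(a' 0, a' 1) ::ₘ s(a' 2, a' 3) ::ₘ M0) := by
    rw [Multiset.add_cons, Multiset.add_cons]
  rw [hre] at hc'
  have hM0w : ∀ e ∈ s(a' 0, a' 1) ::ₘ s(a' 2, a' 3) ::ₘ M0, w ∉ e := by
    have haw' : ∀ k, a' k ≠ w := fun k => ((memT _).1 (ha' k)).1
    intro e he hwe
    rcases Multiset.mem_cons.1 he with rfl | he
    · rcases Sym2.mem_iff.1 hwe with h | h <;> exact haw' _ h.symm
    rcases Multiset.mem_cons.1 he with rfl | he
    · rcases Sym2.mem_iff.1 hwe with h | h <;> exact haw' _ h.symm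
    · exact hM0 e he hwe
  obtain ⟨b', hs', hb', hc''⟩ := split_lemma (fun h => ((memT _).1 h).1 rfl) hbT hM0w hc'
  rw [← hs, ← hs']
  refine op3_color hzw.symm hzt hwt ha' hb' hM0z hM0 ?_
  have hre2 : s(a' 0, a' 1) ::ₘ s(a' 2, a' 3) ::ₘ s(b' 0, b' 1) ::ₘ s(b' 2, b' 3) ::ₘ M0 =
      s(b' 0, b' 1) ::ₘ s(b' 2, b' 3) ::ₘ s(a' 0, a' 1) ::ₘ s(a' 2, a' 3) ::ₘ M0 := by
    simp only [← Multiset.singleton_add]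
    abel
  rw [hre2]
  apply IH
  · simp only [Multiset.card_cons, Multiset.card_add, star4_card]; omega
  · exact (memT _).2 ⟨hwt.symm, hzt.symm, ht⟩
  · intro e he v hv
    rcases Multiset.mem_cons.1 he with rfl | he
    · rcases Sym2.mem_iff.1 hv with rfl | rfl <;> exact hb' _
    rcases Multiset.mem_cons.1 he with rfl | he
    · rcases Sym2.mem_iff.1 hv with rfl | rfl <;> exact hb' _
    rcases Multiset.mem_cons.1 he with rfl | he
    · rcases Sym2.mem_iff.1 hv with rfl | rfl <;> exact ha' _
    rcases Multiset.mem_cons.1 he with rfl | he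
    · rcases Sym2.mem_iff.1 hv with rfl | rfl <;> exact ha' _
    · refine (memT _).2 ⟨?_, ?_, hin e (by simp [he]) v hv⟩
      · intro hh; exact hM0 e he (hh ▸ hv)
      · intro hh; exact hM0z e he (hh ▸ hv)
  · exact hc''
end FRR

namespace FRR
open Relation
open scoped Classical

variable {V : Type*}

/-- The edges at `v` are `va, va, vb, vb, vo`. -/
def nb [DecidableEq V] (M : Multiset (Sym2 V)) (v a b o : V) : Prop :=
  M.filter (fun e => v ∈ e) = s(v, a) ::ₘ s(v, a) ::ₘ s(v, b) ::ₘ s(v, b) ::ₘ s(v, o) ::ₘ 0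

theorem famE_mem {f : Fin 5 → Sym2 V} {e : Sym2 V} : e ∈ famE f ↔ ∃ j, f j = e := by
  simp only [famE, Multiset.mem_map, Multiset.card_map, Finset.mem_val, Finset.mem_univ, true_and, Finset.card_val, Finset.card_univ, Fintype.card_fin]

theorem famE_card {f : Fin 5 → Sym2 V} : (famE f).card = 5 := by
  simp only [famE, Multiset.mem_map, Multiset.card_map, Finset.mem_val, Finset.mem_univ, true_and, Finset.card_val, Finset.card_univ, Fintype.card_fin]

theorem cut_famE_congr {f g : Fin 5 → Sym2 V} {X Y : Set V} (h : ∀ j, cutc X (f j) = cutc Y (g j)) :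
    cut (famE f) X = cut (famE g) Y := by
  rw [famE_five, famE_five]
  simp only [cut_cons, cut_zero, h]

theorem ring_op [DecidableEq V] {S : Finset V} {M M0 : Multiset (Sym2 V)} {t : V} {v o : Fin 5 → V}
    (IH : IndHyp t M.card) (hin : inS S M) (hc : conn S M) (ht : t ∈ S)
    (hvt : ∀ j, v j ≠ t) (hvS : ∀ j, v j ∈ S) (hinj : Function.Injective v)
    (hov : ∀ j k, o j ≠ v k) (hM0 : ∀ e ∈ M0, ∀ j, v j ∉ e)
    (hM : M = famE (fun j => s(v j, o j)) + (famE (fun j => s(v j, v (j + 1))) +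
      (famE (fun j => s(v j, v (j + 1))) + M0))) : Sol S M t := by
  set S' := S.filter (fun x => ∀ j, j ≠ 0 → x ≠ v j) with hS'
  have hoS : ∀ j, o j ∈ S := by
    intro j
    refine hin s(v j, o j) ?_ _ (Sym2.mem_mk_right _ _)
    rw [hM]
    exact Multiset.mem_add.2 (Or.inl (famE_mem.2 ⟨j, rfl⟩))
  have memS' : ∀ x, x ∈ S' ↔ x ∈ S ∧ ∀ j, j ≠ 0 → x ≠ v j := by
    intro x; rw [hS', Finset.mem_filter]
  have ho : ∀ j, o j ∈ S' := fun j => (memS' _).2 ⟨hoS j, fun k _ => hov j k⟩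
  have hv0 : v 0 ∈ S' := (memS' _).2 ⟨hvS 0, fun j hj h => hj (hinj h).symm⟩
  have hsub : Sol S' (famE (fun j => s(v 0, o j)) + M0) t := by
    apply IH
    · rw [hM]; simp only [Multiset.card_add, famE_card]; omega
    · exact (memS' _).2 ⟨ht, fun j _ => (hvt j).symm⟩
    · intro e he x hx
      rcases Multiset.mem_add.1 he with he | he
      · obtain ⟨j, rfl⟩ := famE_mem.1 he
        rcases Sym2.mem_iff.1 hx with rfl | rfl
        · exact hv0
        · exact ho j
      · refine (memS' _).2 ⟨hin e (by rw [hM]; simp [he]) x hx, fun j _ h => ?_⟩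
        exact hM0 e he j (h ▸ hx)
    · intro Z hZ
      set Y : Set V := {x | (x ∈ Z ∧ ∀ j, x ≠ v j) ∨ ((∃ j, x = v j) ∧ v 0 ∈ Z)} with hY
      have hYv : ∀ j, v j ∈ Y ↔ v 0 ∈ Z := by
        intro j
        constructor
        · rintro (⟨_, h⟩ | ⟨_, h⟩)
          · exact absurd rfl (h j)
          · exact h
        · intro h; exact Or.inr ⟨⟨j, rfl⟩, h⟩
      have hYo : ∀ x, (∀ j, x ≠ v j) → (x ∈ Y ↔ x ∈ Z) := by
        intro x hx
        constructor
        · rintro (⟨h, _⟩ | ⟨⟨j, h⟩, _⟩)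
          · exact h
          · exact absurd h (hx j)
        · intro h; exact Or.inl ⟨h, hx⟩
      have hYS : ∀ x ∈ S', (x ∈ Y ↔ x ∈ Z) := by
        intro x hx
        by_cases h0 : x = v 0
        · rw [h0]; exact hYv 0
        · apply hYo
          intro j
          by_cases hj : j = 0
          · rw [hj]; exact h0
          · exact ((memS' _).1 hx).2 j hj
      have hsep : sep S Y := by
        obtain ⟨⟨x, hx, hx'⟩, y, hy, hy'⟩ := hZ
        exact ⟨⟨x, ((memS' _).1 hx).1, (hYS x hx).2 hx'⟩, y, ((memS' _).1 hy).1,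
          fun h => hy' ((hYS y hy).1 h)⟩
      have h5 := hc Y hsep
      have e1 : cut (famE (fun j => s(v j, v (j + 1)))) Y = 0 := by
        rw [famE_five]
        simp only [cut_cons, cut_zero, cutc_mk, hYv, if_true]
      have e2 : cut (famE (fun j => s(v j, o j))) Y = cut (famE (fun j => s(v 0, o j))) Z := by
        apply cut_famE_congr
        intro j
        rw [cutc_mk, cutc_mk, hYv, hYo _ (hov j)]
      have e3 : cut M0 Y = cut M0 Z := by
        apply cut_congr
        intro e he x hx
        apply hYo
        intro j h
        exact hM0 e he j (h ▸ hx)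
      rw [hM, cut_add, cut_add, cut_add, e1, e2, e3] at h5
      rw [cut_add]; omega
  rw [hM]
  refine ring_color hvt ho hov hv0 ?_ (fun e he => hM0 e he 0) hsub
  intro x hx
  by_cases h : ∃ j, x = v j
  · exact Or.inr h
  · push Not at h
    exact Or.inl ((memS' _).2 ⟨hx, fun j _ => h j⟩)

theorem ring_decomp [DecidableEq V] {M : Multiset (Sym2 V)} {v o : Fin 5 → V}
    (hinj : Function.Injective v) (hov : ∀ j k, o j ≠ v k)
    (hnb : ∀ j, nb M (v j) (v (j + 4)) (v (j + 1)) (o j)) :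
    ∃ M0 : Multiset (Sym2 V), (∀ e ∈ M0, ∀ j, v j ∉ e) ∧
      M = famE (fun j => s(v j, o j)) + (famE (fun j => s(v j, v (j + 1))) +
      (famE (fun j => s(v j, v (j + 1))) + M0)) := by
  have hne : ∀ j k : Fin 5, j ≠ k → v j ≠ v k := fun j k h h' => h (hinj h')
  have hvo : ∀ j k, v k ≠ o j := fun j k h => hov j k h.symm
  have h0 := hnb 0
  have h1 := hnb 1
  have h2 := hnb 2
  have h3 := hnb 3
  have h4 := hnb 4
  unfold nb at h0 h1 h2 h3 h4
  simp only [show (0 + 4 : Fin 5) = 4 from rfl, show (1 + 4 : Fin 5) = 0 from rfl,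
    show (2 + 4 : Fin 5) = 1 from rfl, show (3 + 4 : Fin 5) = 2 from rfl,
    show (4 + 4 : Fin 5) = 3 from rfl, show (0 + 1 : Fin 5) = 1 from rfl,
    show (1 + 1 : Fin 5) = 2 from rfl, show (2 + 1 : Fin 5) = 3 from rfl,
    show (3 + 1 : Fin 5) = 4 from rfl, show (4 + 1 : Fin 5) = 0 from rfl] at h0 h1 h2 h3 h4
  set M1 := M.filter (fun e => v 0 ∉ e) with hM1
  set M2 := M1.filter (fun e => v 1 ∉ e) with hM2
  set M3 := M2.filter (fun e => v 2 ∉ e) with hM3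
  set M4 := M3.filter (fun e => v 3 ∉ e) with hM4
  set M5 := M4.filter (fun e => v 4 ∉ e) with hM5
  have n01 := hne 0 1 (by decide)
  have n02 := hne 0 2 (by decide)
  have n03 := hne 0 3 (by decide)
  have n04 := hne 0 4 (by decide)
  have n12 := hne 1 2 (by decide)
  have n13 := hne 1 3 (by decide)
  have n14 := hne 1 4 (by decide)
  have n23 := hne 2 3 (by decide)
  have n24 := hne 2 4 (by decide)
  have n34 := hne 3 4 (by decide)
  have d0 : M = M.filter (fun e => v 0 ∈ e) + M1 := (Multiset.filter_add_not _ M).symm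
  have d1 : M1 = M1.filter (fun e => v 1 ∈ e) + M2 := (Multiset.filter_add_not _ M1).symm
  have d2 : M2 = M2.filter (fun e => v 2 ∈ e) + M3 := (Multiset.filter_add_not _ M2).symm
  have d3 : M3 = M3.filter (fun e => v 3 ∈ e) + M4 := (Multiset.filter_add_not _ M3).symm
  have d4 : M4 = M4.filter (fun e => v 4 ∈ e) + M5 := (Multiset.filter_add_not _ M4).symm
  have f1 : M1.filter (fun e => v 1 ∈ e) = s(v 1, v 2) ::ₘ s(v 1, v 2) ::ₘ s(v 1, o 1) ::ₘ 0 := by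
    rw [hM1, Multiset.filter_comm, h1]
    simp [Multiset.filter_cons, hvo, n01, n02, n03, n04, n12, n13, n14, n23, n24, n34]
  have f2 : M2.filter (fun e => v 2 ∈ e) = s(v 2, v 3) ::ₘ s(v 2, v 3) ::ₘ s(v 2, o 2) ::ₘ 0 := by
    rw [hM2, Multiset.filter_comm, hM1, Multiset.filter_comm (fun e => v 2 ∈ e), h2]
    simp [Multiset.filter_cons, hvo, n01, n02, n03, n04, n12, n13, n14, n23, n24, n34]
  have f3 : M3.filter (fun e => v 3 ∈ e) = s(v 3, v 4) ::ₘ s(v 3, v 4) ::ₘ s(v 3, o 3) ::ₘ 0 := by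
    rw [hM3, Multiset.filter_comm, hM2, Multiset.filter_comm (fun e => v 3 ∈ e), hM1,
      Multiset.filter_comm (fun e => v 3 ∈ e), h3]
    simp [Multiset.filter_cons, hvo, n01, n02, n03, n04, n12, n13, n14, n23, n24, n34]
  have f4 : M4.filter (fun e => v 4 ∈ e) = s(v 4, o 4) ::ₘ 0 := by
    rw [hM4, Multiset.filter_comm, hM3, Multiset.filter_comm (fun e => v 4 ∈ e), hM2,
      Multiset.filter_comm (fun e => v 4 ∈ e), hM1,
      Multiset.filter_comm (fun e => v 4 ∈ e), h4]
    simp [Multiset.filter_cons, hvo, n01, n02, n03, n04, n12, n13, n14, n23, n24, n34]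
  refine ⟨M5, ?_, ?_⟩
  · intro e he j
    simp only [hM5, hM4, hM3, hM2, hM1, Multiset.mem_filter] at he
    fin_cases j
    exacts [he.1.1.1.1.2, he.1.1.1.2, he.1.1.2, he.1.2, he.2]
  · have hfin : M = (s(v 0, v 4) ::ₘ s(v 0, v 4) ::ₘ s(v 0, v 1) ::ₘ s(v 0, v 1) ::ₘ s(v 0, o 0)
        ::ₘ 0) + ((s(v 1, v 2) ::ₘ s(v 1, v 2) ::ₘ s(v 1, o 1) ::ₘ 0) +
        ((s(v 2, v 3) ::ₘ s(v 2, v 3) ::ₘ s(v 2, o 2) ::ₘ 0) +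
        ((s(v 3, v 4) ::ₘ s(v 3, v 4) ::ₘ s(v 3, o 3) ::ₘ 0) + ((s(v 4, o 4) ::ₘ 0) + M5)))) := by
      rw [← h0, ← f1, ← f2, ← f3, ← f4, ← d4, ← d3, ← d2, ← d1, ← d0]
    rw [hfin, famE_five, famE_five]
    simp only [show (0 + 1 : Fin 5) = 1 from rfl,
    show (1 + 1 : Fin 5) = 2 from rfl, show (2 + 1 : Fin 5) = 3 from rfl,
    show (3 + 1 : Fin 5) = 4 from rfl, show (4 + 1 : Fin 5) = 0 from rfl]
    rw [Sym2.eq_swap (a := v 4) (b := v 0)]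
    clear_value M5
    simp only [← Multiset.singleton_add]
    abel
end FRR

namespace FRR
open Relation
open scoped Classical

variable {V : Type*}

structure Ctx [DecidableEq V] (S : Finset V) (M : Multiset (Sym2 V)) (t : V) : Prop where
  ht : t ∈ S
  hin : inS S M
  hl : ∀ e ∈ M, ¬ e.IsDiag
  hc : conn S M
  IH : IndHyp t M.card
  hmin : ∀ e ∈ M, ¬ conn S (M.erase e)

/-- normalized tight sets -/
def Tt (S : Finset V) (M : Multiset (Sym2 V)) (t : V) (X : Set V) : Prop :=
  X ⊆ ↑S ∧ t ∉ X ∧ X.Nonempty ∧ cut M X = 5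

section
variable [DecidableEq V] {S : Finset V} {M : Multiset (Sym2 V)} {t : V} (C : Ctx S M t)

theorem Ctx.ge5 (C : Ctx S M t) {X : Set V} (h1 : X ⊆ ↑S) (h2 : t ∉ X) (h3 : X.Nonempty) :
    5 ≤ cut M X := by
  obtain ⟨x, hx⟩ := h3
  exact C.hc X ⟨⟨x, h1 hx, hx⟩, t, C.ht, h2⟩

theorem Ctx.cut_inter (C : Ctx S M t) (X : Set V) : cut M (X ∩ ↑S) = cut M X := by
  apply cut_congr
  intro e he v hv
  have := C.hin e he v hv
  simp [this]

theorem Ctx.norm (C : Ctx S M t) {X : Set V} {u v : V} (he : s(u, v) ∈ M) (hu : u ∈ X)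
    (ht : t ∉ X) (h : cut M X = 5) : Tt S M t (X ∩ ↑S) :=
  ⟨Set.inter_subset_right, fun h => ht h.1, ⟨u, hu, C.hin _ he u (Sym2.mem_mk_left _ _)⟩,
    by rw [C.cut_inter]; exact h⟩

theorem Ctx.edge_tight (C : Ctx S M t) {u v : V} (he : s(u, v) ∈ M) :
    ∃ Y, Tt S M t Y ∧ ((u ∈ Y ∧ v ∉ Y) ∨ (v ∈ Y ∧ u ∉ Y)) := by
  have huS : u ∈ S := C.hin _ he u (Sym2.mem_mk_left _ _)
  have hvS : v ∈ S := C.hin _ he v (Sym2.mem_mk_right _ _)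
  have h := C.hmin _ he
  unfold conn at h
  push Not at h
  obtain ⟨X, hX, hlt⟩ := h
  have h5 := C.hc X hX
  have hM : M = s(u, v) ::ₘ M.erase s(u, v) := (Multiset.cons_erase he).symm
  have heq : cut M X = cutc X s(u, v) + cut (M.erase s(u, v)) X := by
    conv_lhs => rw [hM]
    rw [cut_cons]
  rw [cutc_mk] at heq
  split_ifs at heq with hif
  · omega
  have hc5 : cut M X = 5 := by omega
  have he' : s(v, u) ∈ M := by rw [Sym2.eq_swap]; exact he
  by_cases hu : u ∈ X
  · have hv : v ∉ X := fun hv => hif (by simp [hu, hv])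
    by_cases ht : t ∈ X
    · exact ⟨Xᶜ ∩ S, C.norm he' hv (fun h => h ht) (by rw [cut_compl]; exact hc5),
        Or.inr ⟨⟨hv, hvS⟩, fun h => h.1 hu⟩⟩
    · exact ⟨X ∩ S, C.norm he hu ht hc5, Or.inl ⟨⟨hu, huS⟩, fun h => hv h.1⟩⟩
  · have hv : v ∈ X := by by_contra hv; exact hif (by simp [hu, hv])
    by_cases ht : t ∈ X
    · exact ⟨Xᶜ ∩ S, C.norm he hu (fun h => h ht) (by rw [cut_compl]; exact hc5),
        Or.inl ⟨⟨hu, huS⟩, fun h => h.1 hv⟩⟩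
    · exact ⟨X ∩ S, C.norm he' hv ht hc5, Or.inr ⟨⟨hv, hvS⟩, fun h => hu h.1⟩⟩

theorem Ctx.laminar (C : Ctx S M t) {X Y : Set V} (hX : Tt S M t X) (hY : Tt S M t Y) {u a b : V}
    (hu : u ∈ X) (hu' : u ∈ Y) (ha : a ∈ X) (ha' : a ∉ Y) (hb : b ∈ Y) (hb' : b ∉ X) : False := by
  obtain ⟨x1, x2, _, x4⟩ := hX
  obtain ⟨y1, y2, _, y4⟩ := hY
  have e1 := C.ge5 (X := X \ Y) (fun x hx => x1 hx.1) (fun h => x2 h.1) ⟨a, ha, ha'⟩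
  have e2 := C.ge5 (X := Y \ X) (fun x hx => y1 hx.1) (fun h => y2 h.1) ⟨b, hb, hb'⟩
  have e3 := C.ge5 (X := X ∩ Y) (fun x hx => x1 hx.1) (fun h => x2 h.1) ⟨u, hu, hu'⟩
  have e4 := C.ge5 (X := X ∪ Y) (Set.union_subset x1 y1) (fun h => h.elim x2 y2) ⟨u, Or.inl hu⟩
  have p1 := cut_posimod M X Y
  have p2 := cut_submod M X Y
  have p3 := cut_union (M := M) (A := X \ Y) (B := X ∩ Y)
    (Set.disjoint_left.2 fun x h1 h2 => h1.2 h2.2)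
  rw [Set.diff_union_inter] at p3
  omega

theorem cut_pos {M : Multiset (Sym2 V)} {X : Set V} (h : cut M X ≠ 0) :
    ∃ u ∈ X, ∃ v, v ∉ X ∧ s(u, v) ∈ M := by
  by_contra hcon
  push Not at hcon
  apply h
  unfold cut
  rw [Multiset.sum_eq_zero_iff]
  intro x hx
  obtain ⟨e, he, rfl⟩ := Multiset.mem_map.1 hx
  induction e with | _ u v
  rw [cutc_mk, if_pos]
  constructor
  · intro hu; by_contra hv; exact hcon u hu v hv he
  · intro hv; by_contra hu; exact hcon v hv u hu (by rw [Sym2.eq_swap]; exact he)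

theorem btw_count {M : Multiset (Sym2 V)} {v w : V} (h : v ≠ w) :
    btw M {v} {w} = M.count s(v, w) := by
  induction M using Multiset.induction with
  | empty => simp [btw]
  | cons e M ih =>
    rw [btw_cons, ih, Multiset.count_cons]
    induction e with | _ a b
    rw [btc_mk, add_comm]
    congr 1
    simp only [Set.mem_singleton_iff, Sym2.eq_iff]
    congr 1
    apply propext
    constructor
    · rintro (⟨h1, h2⟩ | ⟨h1, h2⟩)
      · exact Or.inl ⟨h1.symm, h2.symm⟩
      · exact Or.inr ⟨h1.symm, h2.symm⟩
    · rintro (⟨h1, h2⟩ | ⟨h1, h2⟩)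
      · exact Or.inl ⟨h1.symm, h2.symm⟩
      · exact Or.inr ⟨h1.symm, h2.symm⟩

/-- Case A: all tight sets are singletons. -/
theorem Ctx.caseA (C : Ctx S M t) (h : ∀ X, Tt S M t X → ¬ X.Nontrivial) {x : V} (hx : x ∈ S)
    (hxt : x ≠ t) : Sol S M t := by
  have h5 := C.hc {t} ⟨⟨t, C.ht, rfl⟩, x, hx, hxt⟩
  obtain ⟨u, hu, z, hz, he⟩ := cut_pos (M := M) (X := {t}) (by omega)
  rw [Set.mem_singleton_iff] at hu hz
  subst hu
  rw [Sym2.eq_swap] at he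
  have hzS : z ∈ S := C.hin _ he z (Sym2.mem_mk_left _ _)
  have only : ∀ Y, Tt S M u Y → z ∈ Y → Y = {z} := by
    intro Y hY hzY
    have := Set.not_nontrivial_iff.1 (h Y hY)
    exact this.eq_singleton_of_mem hzY
  refine op2 (z := z) (w := u) C.IH C.hin C.hl C.hc C.ht hz he ?_ ?_
  · obtain ⟨Y, hY, ⟨h1, h2⟩ | ⟨h1, h2⟩⟩ := C.edge_tight he
    · rw [← only Y hY h1]; exact hY.2.2.2
    · exact absurd h1 hY.2.1
  · intro X h1 h2 h3 y hy hyX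
    have := only _ (C.norm he h1 h2 h3) ⟨h1, hzS⟩
    have hy' : y ∈ X ∩ ↑S := ⟨hyX, hy⟩
    rw [this] at hy'
    exact hy'

theorem exists_min_tight (h : ∃ X, Tt S M t X ∧ X.Nontrivial) :
    ∃ X, Tt S M t X ∧ X.Nontrivial ∧ ∀ Y, Tt S M t Y → Y.Nontrivial → Y ⊆ X → Y = X := by
  have hex : ∃ n, ∃ X, Tt S M t X ∧ X.Nontrivial ∧ X.ncard = n := by
    obtain ⟨X, h1, h2⟩ := h
    exact ⟨_, X, h1, h2, rfl⟩
  obtain ⟨X, h1, h2, h3⟩ := Nat.find_spec hex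
  refine ⟨X, h1, h2, fun Y hY hY2 hsub => ?_⟩
  by_contra hne
  have hlt : Y.ncard < X.ncard :=
    Set.ncard_lt_ncard (lt_of_le_of_ne hsub hne) (S.finite_toSet.subset h1.1)
  rw [h3] at hlt
  exact Nat.find_min hex hlt ⟨Y, hY, hY2, rfl⟩

theorem Ctx.inner (C : Ctx S M t) {X : Set V} (hX : Tt S M t X)
    (hmin : ∀ Y, Tt S M t Y → Y.Nontrivial → Y ⊆ X → Y = X) {v w : V} (hv : v ∈ X) (hw : w ∈ X)
    {Y : Set V} (hY : Tt S M t Y) (hvY : v ∈ Y) (hwY : w ∉ Y) : Y = {v} := by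
  have hsub : Y ⊆ X := by
    intro b hb
    by_contra hbX
    exact C.laminar hX hY hv hvY hw hwY hb hbX
  by_cases hn : Y.Nontrivial
  · exact absurd (hmin Y hY hn hsub ▸ hw) hwY
  · exact (Set.not_nontrivial_iff.1 hn).eq_singleton_of_mem hvY

theorem Ctx.inner_gen (C : Ctx S M t) {X : Set V} (hX : Tt S M t X)
    (hmin : ∀ Y, Tt S M t Y → Y.Nontrivial → Y ⊆ X → Y = X) {v w : V} (hv : v ∈ X) (hw : w ∈ X)
    (he : s(v, w) ∈ M)
    {Y : Set V} (hvY : v ∈ Y) (hwY : w ∉ Y) (h5 : cut M Y = 5) :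
    ((∀ x ∈ S, x ∈ Y → x = v) ∧ cut M {v} = 5) ∨
    ((∀ x ∈ S, x ∉ Y → x = w) ∧ cut M {w} = 5) := by
  have hvS : v ∈ S := C.hin _ he v (Sym2.mem_mk_left _ _)
  have hwS : w ∈ S := C.hin _ he w (Sym2.mem_mk_right _ _)
  by_cases ht : t ∈ Y
  · right
    have hT := C.norm (X := Yᶜ) (by rw [Sym2.eq_swap]; exact he : s(w, v) ∈ M) hwY
      (fun h => h ht) (by rw [cut_compl]; exact h5)
    have heq := C.inner hX hmin hw hv hT ⟨hwY, hwS⟩ (fun h => h.1 hvY)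
    refine ⟨fun x hx hxY => ?_, by rw [← heq]; exact hT.2.2.2⟩
    have : x ∈ Yᶜ ∩ ↑S := ⟨hxY, hx⟩
    rw [heq] at this; exact this
  · left
    have hT := C.norm he hvY ht h5
    have heq := C.inner hX hmin hv hw hT ⟨hvY, hvS⟩ (fun h => hwY h.1)
    refine ⟨fun x hx hxY => ?_, by rw [← heq]; exact hT.2.2.2⟩
    have : x ∈ Y ∩ ↑S := ⟨hxY, hx⟩
    rw [heq] at this; exact this

/-- Either done, or inner edges are doubled with tight ends. -/
theorem Ctx.inner_double (C : Ctx S M t) (hns : ¬ Sol S M t) {X : Set V} (hX : Tt S M t X)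
    (hmin : ∀ Y, Tt S M t Y → Y.Nontrivial → Y ⊆ X → Y = X) {v w : V} (hv : v ∈ X) (hw : w ∈ X)
    (he : s(v, w) ∈ M) : cut M {v} = 5 ∧ cut M {w} = 5 ∧ M.count s(v, w) = 2 := by
  have he' : s(w, v) ∈ M := by rw [Sym2.eq_swap]; exact he
  have hvt : v ≠ t := fun h => hX.2.1 (h ▸ hv)
  have hwt : w ≠ t := fun h => hX.2.1 (h ▸ hw)
  have hvw : v ≠ w := fun h => C.hl _ he (by rw [h]; rfl)
  have one : cut M {v} = 5 ∨ cut M {w} = 5 := by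
    obtain ⟨Y, hY, ⟨h1, h2⟩ | ⟨h1, h2⟩⟩ := C.edge_tight he
    · left; rw [← C.inner hX hmin hv hw hY h1 h2]; exact hY.2.2.2
    · right; rw [← C.inner hX hmin hw hv hY h1 h2]; exact hY.2.2.2
  have h1 : cut M {v} = 5 := by
    by_contra hcon
    refine hns (op2 (z := w) (w := v) C.IH C.hin C.hl C.hc C.ht hwt he' (by tauto) ?_)
    intro Y a1 a2 a3
    rcases C.inner_gen hX hmin hw hv he' a1 a2 a3 with h | h
    · exact h.1
    · exact absurd h.2 hcon
  have h2 : cut M {w} = 5 := by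
    by_contra hcon
    refine hns (op2 (z := v) (w := w) C.IH C.hin C.hl C.hc C.ht hvt he h1 ?_)
    intro Y a1 a2 a3
    rcases C.inner_gen hX hmin hv hw he a1 a2 a3 with h | h
    · exact h.1
    · exact absurd h.2 hcon
  have h3 : M.count s(v, w) ≠ 1 := by
    intro hcon
    refine hns (op3 C.IH C.hin C.hl C.hc C.ht hvt hwt he hcon h1 h2 ?_)
    intro Y a1 a2 a3
    rcases C.inner_gen hX hmin hv hw he a1 a2 a3 with h | h
    · exact Or.inl h.1
    · exact Or.inr h.1
  have h4 : M.count s(v, w) ≠ 0 := by rw [Multiset.count_ne_zero]; exact he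
  have h5 := C.ge5 (X := {v} ∪ {w}) (by
    rintro x (h | h)
    · rw [Set.mem_singleton_iff.1 h]; exact hX.1 hv
    · rw [Set.mem_singleton_iff.1 h]; exact hX.1 hw)
    (by rintro (h | h); exacts [hvt h.symm, hwt h.symm]) ⟨v, Or.inl rfl⟩
  have h6 := cut_union (M := M) (A := {v}) (B := {w}) (by simpa using hvw)
  rw [btw_count hvw] at h6
  exact ⟨h1, h2, by omega⟩

theorem Ctx.has_inner (C : Ctx S M t) {X : Set V} (hX : Tt S M t X) (hn : X.Nontrivial) {v : V}
    (hv : v ∈ X) : 5 ≤ 2 * btw M {v} (X \ {v}) ∧ ∃ w ∈ X, s(v, w) ∈ M := by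
  have hne : (X \ {v}).Nonempty := by
    obtain ⟨w, hw, hwv⟩ := hn.exists_ne v
    exact ⟨w, hw, hwv⟩
  have e1 := C.ge5 (X := X \ {v}) (fun x hx => hX.1 hx.1) (fun h => hX.2.1 h.1) hne
  have e2 := C.ge5 (X := {v}) (fun x hx => by rw [Set.mem_singleton_iff.1 hx]; exact hX.1 hv)
    (fun h => hX.2.1 (by rw [Set.mem_singleton_iff.1 h]; exact hv)) ⟨v, rfl⟩
  have e3 := cut_union (M := M) (A := {v}) (B := X \ {v})
    (Set.disjoint_left.2 fun x h1 h2 => h2.2 h1)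
  rw [Set.union_diff_cancel (Set.singleton_subset_iff.2 hv), hX.2.2.2] at e3
  refine ⟨by omega, ?_⟩
  obtain ⟨u, hu, w, hw, he⟩ := btw_pos (M := M) (A := {v}) (B := X \ {v}) (by omega)
  rw [Set.mem_singleton_iff] at hu
  subst hu
  exact ⟨w, hw.1, he⟩
end
end FRR

namespace FRR
open Relation
open scoped Classical

variable {V : Type*}

section
variable [DecidableEq V] {S : Finset V} {M : Multiset (Sym2 V)} {t : V}

theorem Ctx.struct (C : Ctx S M t) (hns : ¬ Sol S M t) {X : Set V} (hX : Tt S M t X)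
    (hn : X.Nontrivial)
    (hmin : ∀ Y, Tt S M t Y → Y.Nontrivial → Y ⊆ X → Y = X) {v : V} (hv : v ∈ X) :
    cut M {v} = 5 ∧ ∃ a b o, a ∈ X ∧ b ∈ X ∧ a ≠ b ∧ a ≠ v ∧ b ≠ v ∧ o ∉ X ∧ nb M v a b o := by
  obtain ⟨N, M0, hM, hcard, hM0, hNz⟩ := star_decomp M v C.hl
  have hfil : M.filter (fun e => v ∈ e) = N.map (fun x => s(v, x)) := by
    rw [hM, Multiset.filter_add, Multiset.filter_eq_self.2, Multiset.filter_eq_nil.2 hM0, add_zero]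
    intro e he
    obtain ⟨x, _, rfl⟩ := Multiset.mem_map.1 he
    exact Sym2.mem_mk_left _ _
  have hinj : Function.Injective (fun x : V => s(v, x)) := by
    intro x y h
    exact Sym2.congr_right.1 h
  have hcnt : ∀ w, N.count w = M.count s(v, w) := by
    intro w
    rw [hM, Multiset.count_add, Multiset.count_eq_zero.2 (fun h => hM0 _ h (Sym2.mem_mk_left _ _)),
      add_zero]
    exact (Multiset.count_map_eq_count' _ N hinj w).symm
  have hdb : ∀ w ∈ X, s(v, w) ∈ M → cut M {v} = 5 ∧ N.count w = 2 := by
    intro w hw he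
    obtain ⟨h1, _, h3⟩ := C.inner_double hns hX hmin hv hw he
    exact ⟨h1, by rw [hcnt]; exact h3⟩
  obtain ⟨hb5, a, haX, hae⟩ := C.has_inner hX hn hv
  obtain ⟨hcut, hca⟩ := hdb a haX hae
  have hav : a ≠ v := fun h => C.hl _ hae (by rw [h]; rfl)
  refine ⟨hcut, ?_⟩
  have hu := btw_union (M := M) (A := {v}) (B := {a}) (C := (X \ {v}) \ {a})
    (by simpa using hav.symm)
    (Set.disjoint_left.2 fun x h1 h2 => h2.1.2 h1)
    (Set.disjoint_left.2 fun x h1 h2 => h2.2 h1)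
  rw [Set.union_sdiff_cancel (Set.singleton_subset_iff.2 (show a ∈ X \ {v} from ⟨haX, hav⟩)), btw_count hav.symm,
    ← hcnt, hca] at hu
  obtain ⟨u, hu1, b, hb, hbe⟩ := btw_pos (M := M) (A := {v}) (B := (X \ {v}) \ {a}) (by omega)
  rw [Set.mem_singleton_iff] at hu1
  subst hu1
  obtain ⟨⟨hbX, hbv⟩, hba⟩ := hb
  rw [Set.mem_singleton_iff] at hbv hba
  obtain ⟨_, hcb⟩ := hdb b hbX hbe
  obtain ⟨N1, hN1⟩ := Multiset.le_iff_exists_add.1 (Multiset.le_count_iff_replicate_le.1 hca.ge)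
  have hcb1 : N1.count b = 2 := by
    rw [hN1, Multiset.count_add, Multiset.count_replicate, if_neg (fun h => hba h.symm)] at hcb
    omega
  obtain ⟨N2, hN2⟩ := Multiset.le_iff_exists_add.1 (Multiset.le_count_iff_replicate_le.1 hcb1.ge)
  have hc2 : N2.card = 1 := by
    rw [hN1, hN2] at hcard
    simp only [Multiset.card_add, Multiset.card_replicate] at hcard
    omega
  obtain ⟨o, rfl⟩ := Multiset.card_eq_one.1 hc2
  have hN : N = a ::ₘ a ::ₘ b ::ₘ b ::ₘ o ::ₘ 0 := by
    rw [hN1, hN2]; rfl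
  refine ⟨a, b, o, haX, hbX, fun h => hba h.symm, hav, hbv, ?_, ?_⟩
  · intro ho
    have h1 : s(u, o) ∈ M := by
      rw [← Multiset.count_pos, ← hcnt, Multiset.count_pos, hN]; simp
    have h2 := (hdb o ho h1).2
    have hab : a ≠ b := fun h => hba h.symm
    rw [hN] at h2 hca hcb
    simp only [Multiset.count_cons, Multiset.count_zero] at h2 hca hcb
    by_cases e1 : o = a
    · subst e1; simp [hab] at h2
    · by_cases e2 : o = b
      · subst e2; simp [hba] at h2
      · simp [e1, e2] at h2
  · unfold nb
    have : M.filter (fun e => u ∈ e) = N.map (fun x => s(u, x)) := by convert hfil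
    convert this using 1
    rw [hN]; simp

theorem nb.swap {v a b o : V} (h : nb M v a b o) : nb M v b a o := by
  unfold nb at *
  rw [h]
  ext e
  simp only [Multiset.count_cons, Multiset.count_zero]
  omega

theorem btw_nb {v a b o : V} (h : nb M v a b o) {R : Set V} (hv : v ∉ R) :
    btw M R {v} = 2 * (if a ∈ R then 1 else 0) + 2 * (if b ∈ R then 1 else 0) +
      (if o ∈ R then 1 else 0) := by
  have hM : M = M.filter (fun e => v ∈ e) + M.filter (fun e => ¬ v ∈ e) :=
    (Multiset.filter_add_not _ _).symm
  have h0 : btw (M.filter (fun e => ¬ v ∈ e)) R {v} = 0 := by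
    by_contra hne
    obtain ⟨x, _, y, hy, he⟩ := btw_pos hne
    rw [Set.mem_singleton_iff] at hy
    subst hy
    exact (Multiset.mem_filter.1 he).2 (Sym2.mem_mk_right _ _)
  rw [hM, btw_add, h0, h]
  simp only [btw_cons, btc_mk, Set.mem_singleton_iff, hv, false_and, false_or, and_true]
  have hz : btw (0 : Multiset (Sym2 V)) R {v} = 0 := rfl
  rw [hz]
  omega

end
end FRR

namespace FRR
open Relation
open scoped Classical

variable {V : Type*}

section
variable [DecidableEq V] {S : Finset V} {M : Multiset (Sym2 V)} {t : V}

theorem nb.sym {v a b o c d o' : V} (h : nb M v a b o) (h' : nb M a c d o') (ho : v ≠ o')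
    : v = c ∨ v = d := by
  have h1 : s(v, a) ∈ M := by
    have : s(v, a) ∈ M.filter (fun e => v ∈ e) := by rw [h]; simp
    exact (Multiset.mem_filter.1 this).1
  have h2 : s(a, v) ∈ M.filter (fun e => a ∈ e) :=
    Multiset.mem_filter.2 ⟨by rw [Sym2.eq_swap]; exact h1, Sym2.mem_mk_left _ _⟩
  rw [h'] at h2
  simp only [Multiset.mem_cons, Sym2.congr_right] at h2
  simp at h2
  tauto

theorem Ctx.nxt (C : Ctx S M t) (hns : ¬ Sol S M t) {X : Set V} (hX : Tt S M t X)
    (hn : X.Nontrivial)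
    (hmin : ∀ Y, Tt S M t Y → Y.Nontrivial → Y ⊆ X → Y = X) {v a b o : V} (hv : v ∈ X)
    (ha : a ∈ X) (h : nb M v a b o) :
    ∃ c o', c ∈ X ∧ c ≠ v ∧ c ≠ a ∧ o' ∉ X ∧ nb M a v c o' := by
  obtain ⟨_, c, d, o', hc, hd, hcd, hca, hda, ho', hnb⟩ := C.struct hns hX hn hmin ha
  rcases h.sym hnb (fun h => ho' (h ▸ hv)) with rfl | rfl
  · exact ⟨d, o', hd, hcd.symm, hda, ho', hnb⟩
  · exact ⟨c, o', hc, hcd, hca, ho', hnb.swap⟩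

theorem cut_step {X A : Set V} {x p q r : V} (h5 : cut M {x} = 5) (hA : A ⊆ X) (hx : x ∉ A)
    (hr : r ∉ X) (h : nb M x p q r) :
    cut M (A ∪ {x}) + 4 * (if p ∈ A then 1 else 0) + 4 * (if q ∈ A then 1 else 0) =
      cut M A + 5 := by
  have h1 := cut_union (M := M) (A := A) (B := {x}) (by simpa using hx)
  have h2 := btw_nb h hx
  rw [if_neg (fun h => hr (hA h))] at h2
  omega

theorem Ctx.caseB (C : Ctx S M t) (hns : ¬ Sol S M t) {X : Set V} (hX : Tt S M t X)
    (hn : X.Nontrivial)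
    (hmin : ∀ Y, Tt S M t Y → Y.Nontrivial → Y ⊆ X → Y = X) : False := by
  have c5 : ∀ v ∈ X, cut M {v} = 5 := fun v hv => (C.struct hns hX hn hmin hv).1
  have nx : ∀ {v a b o : V}, v ∈ X → a ∈ X → nb M v a b o →
    ∃ c o', c ∈ X ∧ c ≠ v ∧ c ≠ a ∧ o' ∉ X ∧ nb M a v c o' :=
    fun hv ha h => C.nxt hns hX hn hmin hv ha h
  have ge : ∀ {Y : Set V}, Y ⊆ X → Y.Nonempty → 5 ≤ cut M Y := fun h1 h2 =>
    C.ge5 (h1.trans hX.1) (fun h => hX.2.1 (h1 h)) h2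
  obtain ⟨v, hv, -⟩ := id hn
  obtain ⟨_, a, b, o0, ha, hb, hab, hav, hbv, ho0, n0⟩ := C.struct hns hX hn hmin hv
  obtain ⟨c, o1, hc, hcv, hca, ho1, n1⟩ := nx hv ha n0
  obtain ⟨d, o2, hd, hdv, hdb, ho2, n2⟩ := nx hv hb n0.swap
  obtain ⟨c', o3, hc', hc'a, hc'c, ho3, n3⟩ := nx ha hc n1.swap
  obtain ⟨d', o4, hd', hd'b, hd'd, ho4, n4⟩ := nx hb hd n2.swap
  have ne : ∀ {x o : V}, x ∈ X → o ∉ X → x ≠ o := fun hx ho h => ho (h ▸ hx)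
  -- the set {v, a}
  have s1 : ({v} : Set V) ⊆ X := by simpa using hv
  have k1 := cut_step (M := M) (c5 a ha) s1 (by simpa using hav) ho1 n1
  simp only [Set.mem_singleton_iff, if_true, hcv, if_false, c5 v hv] at k1
  have s2 : ({v} ∪ {a} : Set V) ⊆ X := Set.union_subset s1 (by simpa using ha)
  have k2 := cut_step (M := M) (x := b) (c5 b hb) s2 (by simp [hbv, hab.symm]) ho2 n2
  have s3 : ({v} ∪ {a} ∪ {b} : Set V) ⊆ X := Set.union_subset s2 (by simpa using hb)
  have g3 := ge s3 ⟨v, by simp⟩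
  have hda : d ≠ a := by
    rintro rfl
    simp at k2 k1 g3
    omega
  have hcb : c ≠ b := by
    rintro rfl
    rcases n1.swap.sym n2 (ne ha ho2) with h | h
    · exact hav h
    · exact hda h.symm
  simp [hdv, hda] at k2
  have k3 := cut_step (M := M) (x := c) (c5 c hc) s3 (by simp [hcv, hca, hcb]) ho3 n3
  have s4 : ({v} ∪ {a} ∪ {b} ∪ {c} : Set V) ⊆ X := Set.union_subset s3 (by simpa using hc)
  have g4 := ge s4 ⟨v, by simp⟩
  have hc'v : c' ≠ v := by
    rintro rfl
    rcases n3.swap.sym n0 (ne hc ho0) with h | h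
    · exact hca h
    · exact hcb h
  have hc'b : c' ≠ b := by
    rintro rfl
    simp at k3
    simp at k2 k1 g4
    omega
  have hcd : c ≠ d := by
    rintro rfl
    rcases n2.swap.sym n3 (ne hb ho3) with h | h
    · exact hab h.symm
    · exact hc'b h.symm
  simp [hc'v, hc'b, hc'a] at k3
  have hdc : d ≠ c := hcd.symm
  have k4 := cut_step (M := M) (x := d) (c5 d hd) s4 (by simp [hdv, hda, hdb, hdc]) ho4 n4
  have s5 : ({v} ∪ {a} ∪ {b} ∪ {c} ∪ {d} : Set V) ⊆ X := Set.union_subset s4 (by simpa using hd)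
  by_cases hring : d' = c
  · subst hring
    have hc'd : c' = d := by
      rcases n4.swap.sym n3 (ne hd ho3) with h | h
      · exact absurd h hda
      · exact h.symm
    subst hc'd
    have hvX : ∀ j, (![v, a, d', c', b] : Fin 5 → V) j ∈ X := by
      intro j; fin_cases j <;> assumption
    have hoX : ∀ j, (![o0, o1, o3, o4, o2] : Fin 5 → V) j ∉ X := by
      intro j; fin_cases j <;> assumption
    have hov : ∀ j k, (![o0, o1, o3, o4, o2] : Fin 5 → V) j ≠ (![v, a, d', c', b] : Fin 5 → V) k :=
      fun j k h => hoX j (h ▸ hvX k)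
    have hinj : Function.Injective (![v, a, d', c', b] : Fin 5 → V) := by
      intro j k h
      fin_cases j <;> fin_cases k <;> first | rfl | (exfalso; simp at h; grind)
    obtain ⟨M0, hM0, hM⟩ := ring_decomp (M := M) (v := ![v, a, d', c', b])
      (o := ![o0, o1, o3, o4, o2]) hinj hov (by
        intro j
        fin_cases j
        · exact n0.swap
        · exact n1
        · exact n3
        · exact n4.swap
        · exact n2.swap)
    exact hns (ring_op C.IH C.hin C.hc C.ht (fun j h => hX.2.1 (h ▸ hvX j)) (fun j => hX.1 (hvX j))
      hinj hov hM0 hM)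
  · have hd'v : d' ≠ v := by
      rintro rfl
      rcases n4.swap.sym n0 (ne hd ho0) with h | h
      · exact hda h
      · exact hdb h
    have hd'a : d' ≠ a := by
      rintro rfl
      rcases n4.swap.sym n1 (ne hd ho1) with h | h
      · exact hdv h
      · exact hdc h
    simp [hd'v, hd'b, hd'a, hring] at k4
    simp at k3 k2 k1
    set Y : Set V := insert d (insert c (insert b (insert a {v}))) with hY
    have hYe : ({v} ∪ {a} ∪ {b} ∪ {c} ∪ {d} : Set V) = Y := by
      rw [hY]; ext x; simp
    rw [hYe] at s5
    have hcY : cut M Y = 9 := by omega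
    have hxz : ∀ {x p q r : V}, nb M x p q r → x ∈ Y → p ∈ Y → r ∉ X →
        btw M {x} (X \ Y) ≤ 2 ∧ (q ∈ Y → btw M {x} (X \ Y) = 0) := by
      intro x p q r h hx hp hr
      rw [btw_comm, btw_nb h (fun h => h.2 hx), if_neg (show p ∉ X \ Y from fun h => h.2 hp),
        if_neg (show r ∉ X \ Y from fun h => hr h.1)]
      constructor
      · split_ifs <;> omega
      · intro hq
        rw [if_neg (show q ∉ X \ Y from fun h => h.2 hq)]
    have b0 := (hxz n0 (by simp [hY]) (by simp [hY]) ho0).2 (by simp [hY])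
    have b1 := (hxz n1 (by simp [hY]) (by simp [hY]) ho1).2 (by simp [hY])
    have b2 := (hxz n2 (by simp [hY]) (by simp [hY]) ho2).2 (by simp [hY])
    have b3 := (hxz n3 (by simp [hY]) (by simp [hY]) ho3).1
    have b4 := (hxz n4 (by simp [hY]) (by simp [hY]) ho4).1
    have dj : ∀ {B : Set V}, B ⊆ Y → Disjoint (X \ Y) B := fun h =>
      Set.disjoint_left.2 fun x h1 h2 => h1.2 (h h2)
    have u1 := btw_union (M := M) (A := X \ Y) (B := {d}) (C := insert c (insert b (insert a {v})))
      (dj (by simp [hY])) (dj (by rw [hY]; exact Set.subset_insert _ _))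
      (by simp [hdv, hda, hdb, hdc])
    have u2 := btw_union (M := M) (A := X \ Y) (B := {c}) (C := (insert b (insert a {v})))
      (dj (by simp [hY])) (dj (by rw [hY]; intro x; simp; tauto))
      (by simp [hcv, hca, hcb])
    have u3 := btw_union (M := M) (A := X \ Y) (B := {b}) (C := (insert a {v}))
      (dj (by simp [hY])) (dj (by rw [hY]; intro x; simp; tauto))
      (by simp [hbv, hab.symm])
    have u4 := btw_union (M := M) (A := X \ Y) (B := {a}) (C := {v})
      (dj (by simp [hY])) (dj (by simp [hY]))
      (by simp [hav])
    have hc' := cut_union (M := M) (A := Y) (B := X \ Y) Set.disjoint_sdiff_right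
    rw [Set.union_sdiff_cancel s5, hX.2.2.2, btw_comm] at hc'
    simp only [Set.singleton_union] at u1 u2 u3 u4
    rw [← hY] at u1
    rw [btw_comm] at b0 b1 b2 b3 b4
    rcases Set.eq_empty_or_nonempty (X \ Y) with he | he
    · have : X = Y := Set.Subset.antisymm (Set.diff_eq_empty.1 he) s5
      rw [← this, hX.2.2.2] at hcY
      omega
    · have := ge Set.diff_subset he
      omega
end
end FRR

namespace FRR
open Relation
open scoped Classical

variable {V : Type*}

theorem sol_all [DecidableEq V] {t : V} : ∀ (n : ℕ) (S : Finset V) (M : Multiset (Sym2 V)), M.card = n → t ∈ S →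
    inS S M → conn S M → Sol S M t := by
  intro n
  induction n using Nat.strong_induction_on with
  | _ n ih =>
  intro S M hn ht hin hc
  have IH : IndHyp t M.card := by
    intro S' M' hlt ht' hin' hc'
    exact ih _ (hn ▸ hlt) S' M' rfl ht' hin' hc'
  have er : ∀ e ∈ M, conn S (M.erase e) → Sol S M t := by
    intro e he hce
    have h1 : M.card = (M.erase e).card + 1 := by
      conv_lhs => rw [← Multiset.cons_erase he]
      simp
    have := IH S (M.erase e) (by omega) ht
      (fun e' he' => hin e' (Multiset.mem_of_mem_erase he')) hce
    rw [← Multiset.cons_erase he]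
    exact Sol_cons e this
  by_cases hl : ∀ e ∈ M, ¬ e.IsDiag
  swap
  · push Not at hl
    obtain ⟨e, he, hd⟩ := hl
    apply er e he
    intro X hX
    have h5 := hc X hX
    rw [← Multiset.cons_erase he, cut_cons] at h5
    induction e with | _ a b
    rw [Sym2.mk_isDiag_iff] at hd
    subst hd
    rw [cutc_mk, if_pos Iff.rfl] at h5
    omega
  by_cases hmin : ∀ e ∈ M, ¬ conn S (M.erase e)
  swap
  · push Not at hmin
    obtain ⟨e, he, h⟩ := hmin
    exact er e he h
  by_cases hS : ∃ x ∈ S, x ≠ t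
  · obtain ⟨x, hx, hxt⟩ := hS
    have C : Ctx S M t := ⟨ht, hin, hl, hc, IH, hmin⟩
    by_cases hex : ∃ X, Tt S M t X ∧ X.Nontrivial
    · by_contra hns
      obtain ⟨X, h1, h2, h3⟩ := exists_min_tight hex
      exact C.caseB hns h1 h2 h3
    · push Not at hex
      exact C.caseA (fun X hX h => Set.not_nontrivial_iff.2 (hex X hX) h) hx hxt
  · push Not at hS
    have hM : M = 0 := by
      by_contra hne
      obtain ⟨e, he⟩ := Multiset.exists_mem_of_ne_zero hne
      refine hmin e he ?_
      rintro X ⟨⟨a, ha, haX⟩, b, hb, hbX⟩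
      rw [hS a ha, ← hS b hb] at haX
      exact absurd haX hbX
    subst hM
    refine ⟨0, rfl, fun e he => absurd he (Multiset.notMem_zero e), fun c v hv => ?_⟩
    rw [hS v hv]
    exact ReflTransGen.refl
end FRR

namespace FRR
open Relation
open scoped Classical

theorem cut_graph {V : Type*} [Fintype V] [DecidableEq V] (G : SimpleGraph V)
    (hconn : EdgeConnected G 5) :
    conn (Finset.univ : Finset V) G.edgeFinset.val := by
  rintro X ⟨⟨a, -, ha⟩, b, -, hb⟩
  by_contra hlt
  push Not at hlt
  set Ff : Finset (Sym2 V) := G.edgeFinset.filter (fun e => cutc X e ≠ 0) with hFf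
  have hle : Ff.card ≤ cut G.edgeFinset.val X := by
    rw [hFf, Finset.card_filter]
    change _ ≤ ∑ e ∈ G.edgeFinset, cutc X e
    apply Finset.sum_le_sum
    intro e _
    split_ifs <;> omega
  have hc := hconn (↑Ff) (by
    intro e he
    have := (Finset.mem_filter.1 (Finset.mem_coe.1 he)).1
    exact SimpleGraph.mem_edgeFinset.1 this) (by
    rw [Set.ncard_coe_finset]; omega)
  obtain ⟨w⟩ := hc.preconnected a b
  obtain ⟨d, _, h1, h2⟩ := w.exists_boundary_dart X ha hb
  have hadj := d.adj
  rw [SimpleGraph.deleteEdges_adj] at hadj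
  apply hadj.2
  refine Finset.mem_coe.2 (Finset.mem_filter.2 ?_)
  refine ⟨SimpleGraph.mem_edgeFinset.2 hadj.1, ?_⟩
  rw [cutc_mk, if_neg]
  · exact one_ne_zero
  · intro h; exact h2 (h.1 h1)

theorem colouring {V : Type*} [Fintype V] [DecidableEq V] (G : SimpleGraph V) (t : V)
    (hconn : EdgeConnected G 5) :
    ∃ col : V → V → Fin 5, (∀ u v, G.Adj u v → grp (col u v) ≠ grp (col v u)) ∧
      ∀ c v, ReflTransGen (fun x y => G.Adj x y ∧ col x y = c) v t := by
  obtain ⟨K, hK, hg, hr⟩ := sol_all (t := t) _ Finset.univ G.edgeFinset.val rfl (Finset.mem_univ t)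
    (fun _ _ v _ => Finset.mem_univ v) (cut_graph G hconn)
  have hinj := Multiset.inj_on_of_nodup_map (s := K) (f := forget) (by
    rw [hK]; exact G.edgeFinset.nodup)
  have hadj : ∀ {c u v}, arc K c u v → G.Adj u v := by
    intro c u v h
    have : s(u, v) ∈ K.map forget := by
      obtain ⟨q, h | h⟩ := h
      · exact Multiset.mem_map.2 ⟨_, h, rfl⟩
      · exact Multiset.mem_map.2 ⟨_, h, Sym2.eq_swap⟩
    rw [hK] at this
    exact SimpleGraph.mem_edgeFinset.1 this
  have huniq : ∀ {c c' u v}, arc K c u v → arc K c' u v → c = c' := by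
    intro c c' u v h h'
    have hne := (hadj h).ne
    obtain ⟨q, h | h⟩ := h <;> obtain ⟨q', h' | h'⟩ := h'
    · have := hinj _ h _ h' rfl
      simp only [Prod.mk.injEq] at this
      exact this.2.1
    · have := hinj _ h _ h' Sym2.eq_swap
      simp only [Prod.mk.injEq] at this
      exact absurd this.1.1 hne
    · have := hinj _ h _ h' Sym2.eq_swap
      simp only [Prod.mk.injEq] at this
      exact absurd this.1.2 hne
    · have := hinj _ h _ h' rfl
      simp only [Prod.mk.injEq] at this
      exact this.2.2
  refine ⟨fun u v => if h : ∃ c, arc K c u v then h.choose else 0, ?_, ?_⟩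
  all_goals
    have hcol : ∀ {c u v}, arc K c u v →
        (if h : ∃ c, arc K c u v then h.choose else 0) = c := by
      intro c u v h
      have hex : ∃ c, arc K c u v := ⟨c, h⟩
      rw [dif_pos hex]
      exact huniq hex.choose_spec h
  · intro u v huv
    have : s(u, v) ∈ K.map forget := by
      rw [hK]; exact SimpleGraph.mem_edgeFinset.2 huv
    obtain ⟨⟨⟨a, b⟩, p, q⟩, hk, he⟩ := Multiset.mem_map.1 this
    have hgk := hg _ hk
    simp only at hgk ⊢
    rcases Sym2.eq_iff.1 he with ⟨h1, h2⟩ | ⟨h1, h2⟩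
    · simp only at h1 h2
      subst h1 h2
      rw [hcol ⟨q, Or.inl hk⟩, hcol ⟨p, Or.inr hk⟩]
      exact hgk
    · simp only at h1 h2
      subst h1 h2
      rw [hcol ⟨q, Or.inl hk⟩, hcol ⟨p, Or.inr hk⟩]
      exact hgk.symm
  · intro c v
    exact rtg_mono (fun x y h => ⟨hadj h, hcol h⟩) (hr c v (Finset.mem_univ v))
end FRR

namespace FRR
open Relation
open scoped Classical

/-- The rim colour with index `n` modulo 4. -/
def rc (n : ℕ) : Fin 5 := ⟨n % 4, by omega⟩

theorem rc_ne {m n : ℕ} (h : m % 4 ≠ n % 4) : rc m ≠ rc n := by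
  intro he; exact h (congrArg Fin.val he)

theorem rc_four (n : ℕ) : rc n ≠ 4 := by
  intro he
  have h := congrArg Fin.val he
  have h4 : ((4 : Fin 5) : ℕ) = 4 := rfl
  rw [h4] at h
  simp only [rc] at h
  omega

theorem grp_rc {m n : ℕ} (h : m % 4 = (n + 2) % 4) : grp (rc m) = grp (rc n) := by
  have h1 : rc m = ⟨(n % 4 + 2) % 4, by omega⟩ := by
    apply Fin.ext; simp only [rc]; omega
  have h2 : rc n = ⟨n % 4, by omega⟩ := rfl
  have hlt : n % 4 < 4 := Nat.mod_lt _ (by norm_num)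
  have key : ∀ (r : ℕ) (hr : r < 4), grp ⟨(r + 2) % 4, by omega⟩ = grp ⟨r, by omega⟩ := by
    intro r hr
    interval_cases r <;> rfl
  rw [h1, h2]
  exact key _ hlt

theorem exists_tree {V : Type*} {R : V → V → Prop} {t : V} (h : ∀ v, ReflTransGen R v t) :
    ∃ (nx : V → V) (d : V → ℕ), ∀ v, v ≠ t → R v (nx v) ∧ d (nx v) < d v := by
  obtain ⟨Rn, R0, RS⟩ : ∃ Rn : ℕ → V → Prop, (∀ v, Rn 0 v ↔ v = t) ∧
      ∀ n v, Rn (n + 1) v ↔ ∃ w, R v w ∧ Rn n w :=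
    ⟨fun n => Nat.rec (motive := fun _ => V → Prop) (fun v => v = t)
      (fun _ P v => ∃ w, R v w ∧ P w) n, fun _ => Iff.rfl, fun _ _ => Iff.rfl⟩
  have hex : ∀ v, ∃ n, Rn n v := by
    intro v
    induction h v using ReflTransGen.head_induction_on with
    | refl => exact ⟨0, (R0 _).2 rfl⟩
    | head h1 _ ih =>
      obtain ⟨n, hn⟩ := ih
      exact ⟨n + 1, (RS _ _).2 ⟨_, h1, hn⟩⟩
  have key : ∀ v, v ≠ t → ∃ w, R v w ∧ Nat.find (hex w) < Nat.find (hex v) := by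
    intro v hv
    have hs := Nat.find_spec (hex v)
    rcases hk : Nat.find (hex v) with _ | k
    · rw [hk] at hs; exact absurd ((R0 _).1 hs) hv
    · rw [hk, RS] at hs
      obtain ⟨w, h1, h2⟩ := hs
      exact ⟨w, h1, Nat.lt_succ_of_le (Nat.find_min' (hex w) h2)⟩
  refine ⟨fun v => if hv : v ≠ t then (key v hv).choose else v, fun v => Nat.find (hex v), ?_⟩
  intro v hv
  simp only [dif_pos hv]
  exact (key v hv).choose_spec

/-- Rim phase states. -/
inductive Rim {V : Type*} (nx : Fin 5 → V → V) (F : Set (Sym2 V)) (t u0 : V) (x : ℕ) : ℕ → V → Prop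
  | start : Rim nx F t u0 x 0 u0
  | fwd {k v} : Rim nx F t u0 x k v → v ≠ t → Rim nx F t u0 x k (nx (rc (x + k)) v)
  | hit {k v} : Rim nx F t u0 x k v → v ≠ t → s(v, nx (rc (x + k)) v) ∈ F → Rim nx F t u0 x (k + 1) v

theorem five_ncard {α : Type*} {F : Set α} (hF : F.Finite) {a b c d e : α} (ha : a ∈ F) (hb : b ∈ F)
    (hc : c ∈ F) (hd : d ∈ F) (he : e ∈ F) (hab : a ≠ b) (hac : a ≠ c) (had : a ≠ d) (hae : a ≠ e)
    (hbc : b ≠ c) (hbd : b ≠ d) (hbe : b ≠ e) (hcd : c ≠ d) (hce : c ≠ e) (hde : d ≠ e) :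
    5 ≤ F.ncard := by
  have h1 : (({a, b, c, d, e} : Finset α)).card = 5 := by
    simp [Finset.card_insert_of_notMem, *]
  rw [← h1, ← Set.ncard_coe_finset]
  apply Set.ncard_le_ncard _ hF
  intro y hy
  simp at hy
  rcases hy with rfl | rfl | rfl | rfl | rfl <;> assumption

section
variable {V : Type*} {G : SimpleGraph V} {col : V → V → Fin 5} {nx : Fin 5 → V → V}
  {d : Fin 5 → V → ℕ} {t : V} {F : Set (Sym2 V)}

theorem Rim.inv0 {u0 : V} {x : ℕ} (hd : ∀ c v, v ≠ t → d c (nx c v) < d c v)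
    {k : ℕ} {v : V} (h : Rim nx F t u0 x k v) (hk : k = 0) : d (rc x) v ≤ d (rc x) u0 := by
  induction h with
  | start => exact le_rfl
  | @fwd k v _ hv ih =>
    subst hk
    exact ((hd _ v hv).le).trans (ih rfl)
  | hit _ _ _ _ => omega

theorem Rim.invS {u0 : V} {x : ℕ} (hd : ∀ c v, v ≠ t → d c (nx c v) < d c v)
    {k k' : ℕ} {v : V} (h : Rim nx F t u0 x k' v) (hk : k' = k + 1) :
    ∃ p, Rim nx F t u0 x k p ∧ p ≠ t ∧ s(p, nx (rc (x + k)) p) ∈ F ∧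
      d (rc (x + k + 1)) v ≤ d (rc (x + k + 1)) p := by
  induction h with
  | start => omega
  | @fwd k v _ hv ih =>
    subst hk
    obtain ⟨p, h1, h2, h3, h4⟩ := ih rfl
    exact ⟨p, h1, h2, h3, ((hd _ v hv).le).trans h4⟩
  | @hit k1 v h1 h2 h3 _ =>
    obtain rfl : k1 = k := by omega
    exact ⟨v, h1, h2, h3, le_rfl⟩

theorem no_seven (hg : ∀ u v, G.Adj u v → grp (col u v) ≠ grp (col v u))
    (hadj : ∀ c v, v ≠ t → G.Adj v (nx c v)) (hcol : ∀ c v, v ≠ t → col v (nx c v) = c)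
    (hd : ∀ c v, v ≠ t → d c (nx c v) < d c v) (hF : F.Finite) (h4 : F.ncard ≤ 4)
    {u0 : V} (hu0 : u0 ≠ t) (he : s(u0, nx 4 u0) ∈ F) {x : ℕ}
    (hx : ∀ i, nx 4 u0 ≠ t → nx (rc i) (nx 4 u0) = u0 → rc i = rc x) {v : V}
    (h : Rim nx F t u0 x 7 v) : False := by
  obtain ⟨p6, r6, t6, f6, l7⟩ := h.invS hd (k := 6) rfl
  obtain ⟨p5, r5, t5, f5, l6⟩ := r6.invS hd (k := 5) rfl
  obtain ⟨p4, r4, t4, f4, l5⟩ := r5.invS hd (k := 4) rfl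
  obtain ⟨p3, r3, t3, f3, l4⟩ := r4.invS hd (k := 3) rfl
  obtain ⟨p2, r2, t2, f2, l3⟩ := r3.invS hd (k := 2) rfl
  obtain ⟨p1, r1, t1, f1, l2⟩ := r2.invS hd (k := 1) rfl
  obtain ⟨p0, r0, t0, f0, l1⟩ := r1.invS hd (k := 0) rfl
  have l0 := r0.inv0 hd rfl
  clear r0 r1 r2 r3 r4 r5 r6 h
  -- equal tree edges
  have eqE : ∀ {c c' : Fin 5} {p q : V}, p ≠ t → q ≠ t → s(p, nx c p) = s(q, nx c' q) →
      (p = q ∧ c = c') ∨ (q = nx c p ∧ p = nx c' q ∧ grp c ≠ grp c') := by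
    intro c c' p q hp hq heq
    rcases Sym2.eq_iff.1 heq with ⟨h1, h2⟩ | ⟨h1, h2⟩
    · left
      refine ⟨h1, ?_⟩
      have a1 := hcol c p hp
      have a2 := hcol c' q hq
      rw [h2, h1] at a1
      rw [← a1, a2]
    · right
      refine ⟨h2.symm, h1, ?_⟩
      have a1 := hcol c p hp
      have a2 := hcol c' q hq
      have a3 := hg _ _ (hadj c p hp)
      rw [a1] at a3
      rw [← h1, ← h2] at a2
      rw [a2] at a3
      exact a3
  have adj1 : ∀ {i : ℕ} {p q : V}, p ≠ t → q ≠ t →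
      d (rc (x + i + 1)) q ≤ d (rc (x + i + 1)) p →
      s(p, nx (rc (x + i)) p) ≠ s(q, nx (rc (x + (i + 1))) q) := by
    intro i p q hp hq hl heq
    rcases eqE hp hq heq with ⟨_, h2⟩ | ⟨h1, h2, _⟩
    · exact rc_ne (by omega) h2
    · have := hd (rc (x + (i + 1))) q hq
      rw [← h2] at this
      exact absurd hl (not_le.2 this)
  have adj2 : ∀ {i : ℕ} {p q : V}, p ≠ t → q ≠ t →
      s(p, nx (rc (x + i)) p) ≠ s(q, nx (rc (x + (i + 2))) q) := by
    intro i p q hp hq heq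
    rcases eqE hp hq heq with ⟨_, h2⟩ | ⟨h1, h2, h3⟩
    · exact rc_ne (by omega) h2
    · exact h3 (grp_rc (by omega)).symm
  have eNe : ∀ {i : ℕ} {p : V}, p ≠ t → s(p, nx (rc (x + i)) p) = s(u0, nx 4 u0) →
      p = nx 4 u0 ∧ nx (rc (x + i)) p = u0 ∧ i % 4 = 0 := by
    intro i p hp heq
    rcases eqE hp hu0 heq with ⟨_, h2⟩ | ⟨h1, h2, _⟩
    · exact absurd h2 (rc_four _)
    · refine ⟨h2, h1.symm, ?_⟩
      have := hx (x + i) (h2 ▸ hp) (by rw [← h2]; exact h1.symm)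
      by_contra hne
      exact rc_ne (by omega) this
  have eNe' : ∀ {i : ℕ} {p : V}, p ≠ t → i % 4 ≠ 0 →
      s(p, nx (rc (x + i)) p) ≠ s(u0, nx 4 u0) := fun hp hi h => hi (eNe hp h).2.2
  -- tree `x` below `u0`
  have eX : ∀ {i : ℕ} {p : V}, p ≠ t → i % 4 = 0 → d (rc x) p ≤ d (rc x) u0 →
      s(p, nx (rc (x + i)) p) ≠ s(u0, nx 4 u0) := by
    intro i p hp hi hl h
    obtain ⟨_, h2, _⟩ := eNe hp h
    have h3 : rc (x + i) = rc x := by apply Fin.ext; simp only [rc]; omega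
    rw [h3] at h2
    have := hd (rc x) p hp
    rw [h2] at this
    omega
  have a01 := adj1 (i := 0) t0 t1 l1
  have a12 := adj1 (i := 1) t1 t2 l2
  have a23 := adj1 (i := 2) t2 t3 l3
  have a34 := adj1 (i := 3) t3 t4 l4
  have a45 := adj1 (i := 4) t4 t5 l5
  have a56 := adj1 (i := 5) t5 t6 l6
  have b02 := adj2 (i := 0) t0 t2
  have b13 := adj2 (i := 1) t1 t3
  have b24 := adj2 (i := 2) t2 t4
  have b35 := adj2 (i := 3) t3 t5
  have b46 := adj2 (i := 4) t4 t6
  have e0 := eX (i := 0) t0 rfl l0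
  have e1 := eNe' (i := 1) t1 (by norm_num)
  have e2 := eNe' (i := 2) t2 (by norm_num)
  have e3 := eNe' (i := 3) t3 (by norm_num)
  have e5 := eNe' (i := 5) t5 (by norm_num)
  have e6 := eNe' (i := 6) t6 (by norm_num)
  simp only [zero_add, Nat.reduceAdd] at a01 a12 a23 a34 a45 a56 b02 b13 b24 b35 b46
  have pick : ∀ {y}, y ∈ F → y ≠ s(u0, nx 4 u0) → y = s(p0, nx (rc (x + 0)) p0) ∨
      y = s(p1, nx (rc (x + 1)) p1) ∨ y = s(p2, nx (rc (x + 2)) p2) := by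
    intro y hy hye
    by_contra hcon
    push Not at hcon
    have := five_ncard hF f0 f1 f2 he hy a01 b02 e0 hcon.1.symm a12 e1 hcon.2.1.symm e2
      hcon.2.2.symm hye.symm
    omega
  have h3 : s(p3, nx (rc (x + 3)) p3) = s(p0, nx (rc (x + 0)) p0) := by
    rcases pick f3 e3 with h | h | h
    · exact h
    · exact absurd h.symm b13
    · exact absurd h.symm a23
  have hs : p3 = nx (rc x) p0 := by
    rcases eqE t3 t0 h3 with ⟨_, h⟩ | ⟨_, h, _⟩
    · exact absurd h (rc_ne (by omega))
    · exact h
  have l4' : d (rc x) p4 ≤ d (rc x) p3 := by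
    have hr : rc (x + 3 + 1) = rc x := by apply Fin.ext; simp only [rc]; omega
    rw [hr] at l4; exact l4
  have e4 := eX (i := 4) t4 rfl (by
    have := hd (rc x) p0 t0
    rw [← hs] at this
    omega)
  have h4' : s(p4, nx (rc (x + 4)) p4) = s(p1, nx (rc (x + 1)) p1) := by
    rcases pick f4 e4 with h | h | h
    · rw [← h3] at h; exact absurd h.symm a34
    · exact h
    · exact absurd h.symm b24
  have h5 : s(p5, nx (rc (x + 5)) p5) = s(p2, nx (rc (x + 2)) p2) := by
    rcases pick f5 e5 with h | h | h
    · rw [← h3] at h; exact absurd h.symm b35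
    · rw [← h4'] at h; exact absurd h.symm a45
    · exact h
  have h6 : s(p6, nx (rc (x + 6)) p6) = s(p0, nx (rc (x + 0)) p0) := by
    rcases pick f6 e6 with h | h | h
    · exact h
    · rw [← h4'] at h; exact absurd h.symm b46
    · rw [← h5] at h; exact absurd h.symm a56
  have c1 := eqE t6 t0 h6
  rcases c1 with ⟨_, h⟩ | ⟨_, _, h⟩
  · exact absurd h (rc_ne (by omega))
  · exact h (grp_rc (by omega))
end
end FRR

namespace FRR
open Relation
open scoped Classical

section
variable {V : Type*}

noncomputable def mode (col : V → V → Fin 5) (nx : Fin 5 → V → V) (v : V) : Option V → Fin 5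
  | none => 4
  | some u => if nx (col u v) u = v then col u v else 4

noncomputable def rimF (nx : Fin 5 → V → V) (v : V) (m : ℕ) (A : Set V) : V :=
  if h : ∃ j, nx (rc (m + j)) v ∈ A then nx (rc (m + Nat.find h)) v
  else if h : A.Nonempty then h.choose else v

theorem rimF_mem (nx : Fin 5 → V → V) (v : V) (m : ℕ) (A : Set V) (hA : A.Nonempty) :
    rimF nx v m A ∈ A := by
  unfold rimF
  split_ifs with h
  · exact Nat.find_spec h
  · exact hA.choose_spec

noncomputable def startC (col : V → V → Fin 5) (nx : Fin 5 → V → V) (v : V) : ℕ :=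
  if nx (col (nx 4 v) v) (nx 4 v) = v then (col (nx 4 v) v).val else 0

noncomputable def fwdF (col : V → V → Fin 5) (nx : Fin 5 → V → V) (v : V) (ip : Option V)
    (A : Set V) : V :=
  if mode col nx v ip = 4 then (if nx 4 v ∈ A then nx 4 v else rimF nx v (startC col nx v) A)
  else rimF nx v (mode col nx v ip).val A

noncomputable def scheme (G : SimpleGraph V) (col : V → V → Fin 5) (nx : Fin 5 → V → V) :
    FwdScheme G where
  fwd := fwdF col nx
  mem := by
    intro v ip A hA
    unfold fwdF
    split_ifs with h1 h2
    · exact h2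
    · exact rimF_mem _ _ _ _ hA
    · exact rimF_mem _ _ _ _ hA

end

theorem main_aux {V : Type*} [Fintype V] [DecidableEq V]
    (G : SimpleGraph V) (t : V) (hconn : EdgeConnected G 5) :
    ∃ P : FwdScheme G, DynResilient P t 4 := by
  obtain ⟨col, hg, hr⟩ := colouring G t hconn
  choose nx d hnx using fun c => exists_tree (hr c)
  have hadj : ∀ c v, v ≠ t → G.Adj v (nx c v) := fun c v hv => (hnx c v hv).1.1
  have hcol : ∀ c v, v ≠ t → col v (nx c v) = c := fun c v hv => (hnx c v hv).1.2
  have hd : ∀ c v, v ≠ t → d c (nx c v) < d c v := fun c v hv => (hnx c v hv).2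
  refine ⟨scheme G col nx, ?_⟩
  intro F hFG hF4 σ hσ s _ _
  have hF : F.Finite := Set.toFinite F
  set tr := (scheme G col nx).traj σ t s with htr
  have step : ∀ n v ip, tr n = (v, ip) → v ≠ t → ∀ w,
      w = fwdF col nx v ip {u : V | G.Adj v u ∧ s(v, u) ∉ σ n} →
      w ∈ {u : V | G.Adj v u ∧ s(v, u) ∉ σ n} → tr (n + 1) = (w, some v) := by
    intro n v ip h hv w hw hwA
    have h' : (scheme G col nx).traj σ t s n = (v, ip) := h
    rw [htr, FwdScheme.traj]
    simp only [h', if_neg hv]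
    rw [if_pos ⟨w, hwA⟩, hw]
    rfl
  have hmode : ∀ c v, v ≠ t → mode col nx (nx c v) (some v) = c := by
    intro c v hv
    simp only [mode, hcol c v hv, if_true]
  have inF : ∀ n c v, v ≠ t → nx c v ∉ {u : V | G.Adj v u ∧ s(v, u) ∉ σ n} →
      s(v, nx c v) ∈ F := by
    intro n c v hv h
    apply hσ n
    by_contra hcon
    exact h ⟨hadj c v hv, hcon⟩
  let Good : V → ℕ → Prop := fun u0 x => u0 ≠ t ∧ s(u0, nx 4 u0) ∈ F ∧
    ∀ i, nx 4 u0 ≠ t → nx (rc i) (nx 4 u0) = u0 → rc i = rc x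
  have seven : ∀ u0 x v, Good u0 x → ¬ Rim nx F t u0 x 7 v := fun u0 x v hG h =>
    no_seven hg hadj hcol hd hF hF4 hG.1 hG.2.1 hG.2.2 h
  -- one step in the rim phase
  have rstep : ∀ n v ip u0 x k m, tr n = (v, ip) → v ≠ t → Good u0 x → Rim nx F t u0 x k v →
      fwdF col nx v ip {u : V | G.Adj v u ∧ s(v, u) ∉ σ n} =
        rimF nx v m {u : V | G.Adj v u ∧ s(v, u) ∉ σ n} →
      m % 4 = (x + k) % 4 →
      ∃ j, Rim nx F t u0 x (k + j) v ∧ tr (n + 1) = (nx (rc (x + (k + j))) v, some v) := by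
    intro n v ip u0 x k m htn hv hG hR hf hm
    set A : Set V := {u : V | G.Adj v u ∧ s(v, u) ∉ σ n} with hA
    have hrc : ∀ j, rc (m + j) = rc (x + (k + j)) := by
      intro j; apply Fin.ext; simp only [rc]; omega
    have many : ∀ j, (∀ i, i < j → nx (rc (m + i)) v ∉ A) → Rim nx F t u0 x (k + j) v := by
      intro j
      induction j with
      | zero => intro _; exact hR
      | succ j ih =>
        intro h
        have h1 := ih (fun i hi => h i (by omega))
        have h2 := inF n _ v hv (h j (by omega))
        rw [hrc] at h2
        exact Rim.hit h1 hv h2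
    have hex : ∃ j, nx (rc (m + j)) v ∈ A := by
      by_contra hcon
      push Not at hcon
      have hk : k ≤ 7 ∨ 7 < k := le_or_gt _ _
      rcases hk with hk | hk
      · have := many (7 - k) (fun i _ => hcon i)
        rw [show k + (7 - k) = 7 by omega] at this
        exact seven u0 x v hG this
      · have : ∀ {k v}, Rim nx F t u0 x k v → k ≤ 6 := by
          intro k v h
          induction h with
          | start => omega
          | fwd _ _ ih => exact ih
          | @hit k v h1 h2 h3 ih =>
            by_contra hc
            have hk6 : k + 1 = 7 := by omega
            have := Rim.hit h1 h2 h3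
            rw [hk6] at this
            exact seven u0 x v hG this
        have := this hR
        omega
    refine ⟨Nat.find hex, many _ (fun i hi => Nat.find_min hex hi), ?_⟩
    refine step n v ip htn hv _ ?_ ?_
    · rw [← hA, hf, rimF, dif_pos hex, hrc]
      congr!
    · rw [← hrc]; exact Nat.find_spec hex
  have rimT : ∀ K D n v ip u0 x k, tr n = (v, ip) → Good u0 x → Rim nx F t u0 x k v →
      mode col nx v ip = rc (x + k) → 7 - k = K → d (rc (x + k)) v = D → ∃ n', (tr n').1 = t := by
    intro K
    induction K using Nat.strong_induction_on with
    | _ K ihK =>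
    intro D
    induction D using Nat.strong_induction_on with
    | _ D ihD =>
    intro n v ip u0 x k htn hG hR hm hK hD
    by_cases hv : v = t
    · exact ⟨n, by rw [htn]; exact hv⟩
    obtain ⟨j, hj, hn⟩ := rstep n v ip u0 x k (mode col nx v ip).val htn hv hG hR
      (by rw [fwdF, if_neg]; rw [hm]; exact rc_four _) (by rw [hm]; simp only [rc]; omega)
    have hj' := Rim.fwd hj hv
    rcases Nat.eq_zero_or_pos j with rfl | hpos
    · exact ihD _ (hD ▸ hd (rc (x + k)) v hv) (n + 1) _ _ u0 x k hn hG hj' (hmode _ v hv) hK rfl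
    · have hk7 : k < 7 := by
        by_contra hc
        have : ∀ {k v}, Rim nx F t u0 x k v → k ≤ 6 := by
          intro k v h
          induction h with
          | start => omega
          | fwd _ _ ih => exact ih
          | @hit k v h1 h2 h3 ih =>
            by_contra hc
            have hk6 : k + 1 = 7 := by omega
            have := Rim.hit h1 h2 h3
            rw [hk6] at this
            exact seven u0 x v hG this
        have := this hR
        omega
      exact ihK (7 - (k + j)) (by omega) _ (n + 1) _ _ u0 x (k + j) hn hG hj' (hmode _ v hv) rfl rfl
  have eT : ∀ D n v ip, tr n = (v, ip) → mode col nx v ip = 4 → d 4 v = D →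
      ∃ n', (tr n').1 = t := by
    intro D
    induction D using Nat.strong_induction_on with
    | _ D ihD =>
    intro n v ip htn hm hD
    by_cases hv : v = t
    · exact ⟨n, by rw [htn]; exact hv⟩
    by_cases hact : nx 4 v ∈ {u : V | G.Adj v u ∧ s(v, u) ∉ σ n}
    · have hn := step n v ip htn hv (nx 4 v) (by rw [fwdF, if_pos hm, if_pos hact]) hact
      exact ihD _ (hD ▸ hd 4 v hv) (n + 1) _ _ hn (hmode _ v hv) rfl
    · have hG : Good v (startC col nx v) := by
        refine ⟨hv, inF n 4 v hv hact, ?_⟩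
        intro i hi hnxi
        have h1 := hcol (rc i) _ hi
        rw [hnxi] at h1
        unfold startC
        rw [h1, if_pos hnxi]
        apply Fin.ext; simp only [rc]; omega
      obtain ⟨j, hj, hn⟩ := rstep n v ip v (startC col nx v) 0 (startC col nx v) htn hv hG
        Rim.start (by rw [fwdF, if_pos hm, if_neg hact]) rfl
      exact rimT _ _ (n + 1) _ _ v _ _ hn hG (Rim.fwd hj hv) (hmode _ v hv) rfl rfl
  exact eT _ 0 s none rfl rfl rfl

end FRR


namespace FRR

open scoped Classical

variable {V : Type*} [Fintype V] [DecidableEq V]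

/-- Theorem 3: every finite 5-edge-connected graph with destination `t` admits a
routing process that is 4-resilient against dynamic failures. -/
theorem five_connected_four_resilient
    (G : SimpleGraph V) (t : V) (hconn : EdgeConnected G 5) :
    ∃ P : FwdScheme G, DynResilient P t 4 := by
  exact main_aux G t hconn

end FRR
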